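/- arXiv:1511.02982 — 3 statements merged into one kernel-verified Lean document; each statement's English description precedes it below -/
import Mathlib

section
/- Let K ⊆ 𝕊_d be a closed A(𝔹_d)-totally null set and let λ ∈ 𝔹_d. Then: (i) the restriction map is surjective from A(𝔹_d) onto C(K ∪ {λ}), i.e., every continuous function on K ∪ {λ} is the restriction of some φ ∈ A(𝔹_d); and (ii) for every φ ∈ A(𝔹_d), the distance from φ to the ideal I(K ∪ {λ}) equals the supremum of |φ| on K ∪ {λ}: inf{‖φ − ψ‖_∞ : ψ ∈ I(K ∪ {λ})} = sup{|φ(z)| : z ∈ K ∪ {λ}}. Consequently the restriction map induces an isometric isomorphism of A(𝔹_d)/I(K ∪ {λ}) onto C(K ∪ {λ}). -/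
open MeasureTheory Metric Set Filter Topology

noncomputable section

abbrev CB (d : ℕ) : Set (EuclideanSpace ℂ (Fin d)) := Metric.closedBall 0 1

instance (d : ℕ) : CompactSpace (CB d) :=
  isCompact_iff_compactSpace.mp (isCompact_closedBall _ _)

instance (d : ℕ) : MeasurableSpace (EuclideanSpace ℂ (Fin d)) := borel _

instance (d : ℕ) : BorelSpace (EuclideanSpace ℂ (Fin d)) := ⟨rfl⟩

def polyAlg (d : ℕ) : Subalgebra ℂ C(CB d, ℂ) :=
  Algebra.adjoin ℂ
    { f : C(CB d, ℂ) | ∃ i : Fin d,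
        f = ⟨fun z => (z : EuclideanSpace ℂ (Fin d)) i,
             (EuclideanSpace.proj (𝕜 := ℂ) i).continuous.comp continuous_subtype_val⟩ }

def ballAlgSub (d : ℕ) : Subalgebra ℂ C(CB d, ℂ) := (polyAlg d).topologicalClosure

def ballAlg (d : ℕ) : Set C(CB d, ℂ) := ballAlgSub d

def sphereD (d : ℕ) : Set (CB d) := {z | ‖(z : EuclideanSpace ℂ (Fin d))‖ = 1}

def openD (d : ℕ) : Set (CB d) := {z | ‖(z : EuclideanSpace ℂ (Fin d))‖ < 1}

def ZS (d : ℕ) (S : Set C(CB d, ℂ)) : Set (CB d) := {z | ∀ φ ∈ S, φ z = 0}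

def IX (d : ℕ) (X : Set (CB d)) : Set C(CB d, ℂ) :=
  {φ | φ ∈ ballAlg d ∧ ∀ z ∈ X, φ z = 0}

def IsZeroSet (d : ℕ) (X : Set (CB d)) : Prop :=
  ∃ S ⊆ ballAlg d, X = ZS d S

/-- A representing measure for a point of the closed ball: a finite positive regular
Borel measure integrating every function of the ball algebra to its value at the point. -/
def IsRepMeasure (d : ℕ) (lam : CB d) (μ : Measure (CB d)) : Prop :=
  IsFiniteMeasure μ ∧ μ.Regular ∧ ∀ φ ∈ ballAlg d, φ lam = ∫ z, φ z ∂μ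

/-- `X̂₀` : `X₀` together with all points of the open ball having a representing measure
supported on `X₀`. -/
def hatSet (d : ℕ) (X0 : Set (CB d)) : Set (CB d) :=
  X0 ∪ {lam | lam ∈ openD d ∧
    ∃ μ : Measure (CB d), IsRepMeasure d lam μ ∧ μ X0ᶜ = 0}

/-- `z` is an isolated point of the set `A`. -/
def IsIsolatedIn (d : ℕ) (A : Set (CB d)) (z : CB d) : Prop :=
  z ∈ A ∧ ∃ U : Set (CB d), IsOpen U ∧ U ∩ A = {z}

/-- A closed ideal of the ball algebra. -/
structure IsClosedIdeal (d : ℕ) (J : Set C(CB d, ℂ)) : Prop where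
  subset : J ⊆ ballAlg d
  closed : IsClosed J
  zero_mem : (0 : C(CB d, ℂ)) ∈ J
  add_mem : ∀ f ∈ J, ∀ g ∈ J, f + g ∈ J
  smul_mem : ∀ (c : ℂ), ∀ f ∈ J, c • f ∈ J
  mul_mem : ∀ f ∈ ballAlg d, ∀ g ∈ J, f * g ∈ J

/-- An `A(𝔹_d)`-Henkin (finite positive regular Borel) measure on the sphere. -/
def IsHenkin (d : ℕ) (μ : Measure (CB d)) : Prop :=
  IsFiniteMeasure μ ∧ μ.Regular ∧ μ (sphereD d)ᶜ = 0 ∧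
    ∀ f : ℕ → C(CB d, ℂ), (∀ n, f n ∈ ballAlg d) → (∃ C : ℝ, ∀ n, ‖f n‖ ≤ C) →
      (∀ z ∈ openD d, Tendsto (fun n => f n z) atTop (𝓝 0)) →
      Tendsto (fun n => ∫ z, f n z ∂μ) atTop (𝓝 0)

/-- An `A(𝔹_d)`-totally null subset of the sphere. -/
def IsTotallyNull (d : ℕ) (K : Set (CB d)) : Prop :=
  K ⊆ sphereD d ∧ ∀ μ : Measure (CB d), IsHenkin d μ → μ K = 0

/-- A complex regular Borel measure on the sphere, given by its polar decomposition:
total variation `var` (a finite positive regular Borel measure concentrated on the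
sphere) and a unimodular density. -/
structure CMeasure (d : ℕ) where
  var : Measure (CB d)
  density : CB d → ℂ
  finite : IsFiniteMeasure var
  regular : var.Regular
  measurable_density : Measurable density
  norm_density : ∀ z, ‖density z‖ = 1
  onSphere : var (sphereD d)ᶜ = 0

/-- Integral of a continuous function against a complex measure. -/
def cInt (d : ℕ) (μ : CMeasure d) (φ : C(CB d, ℂ)) : ℂ :=
  ∫ z, φ z * μ.density z ∂μ.var

/-- An `A(𝔹_d)`-Henkin complex measure on the sphere. -/
def IsHenkinC (d : ℕ) (μ : CMeasure d) : Prop :=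
  ∀ f : ℕ → C(CB d, ℂ), (∀ n, f n ∈ ballAlg d) → (∃ C : ℝ, ∀ n, ‖f n‖ ≤ C) →
    (∀ z ∈ openD d, Tendsto (fun n => f n z) atTop (𝓝 0)) →
    Tendsto (fun n => cInt d μ (f n)) atTop (𝓝 0)

/-- An `A(𝔹_d)`-totally singular complex measure: its total variation is mutually
singular with that of every Henkin complex measure. -/
def IsTotallySingularC (d : ℕ) (μ : CMeasure d) : Prop :=
  ∀ ν : CMeasure d, IsHenkinC d ν → μ.var ⟂ₘ ν.var

/-- An `A(𝔹_d)`-totally null Borel subset of the sphere (complex-measure version). -/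
def IsTotallyNullC (d : ℕ) (K : Set (CB d)) : Prop :=
  K ⊆ sphereD d ∧ ∀ μ : CMeasure d, IsHenkinC d μ → μ.var K = 0

/-- The polynomial function on the closed ball defined by a formal polynomial. -/
def polyEval (d : ℕ) : MvPolynomial (Fin d) ℂ →ₐ[ℂ] C(CB d, ℂ) :=
  MvPolynomial.aeval fun i => ⟨fun z => (z : EuclideanSpace ℂ (Fin d)) i,
    (EuclideanSpace.proj (𝕜 := ℂ) i).continuous.comp continuous_subtype_val⟩

theorem polyEval_apply {d : ℕ} (p : MvPolynomial (Fin d) ℂ) (z : CB d) :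
    polyEval d p z = MvPolynomial.eval (fun i => z.1 i) p := by
  induction p using MvPolynomial.induction_on with
  | C a => simp [polyEval]
  | add p q hp hq => simp [hp, hq]
  | mul_X p i hp =>
    rw [map_mul, ContinuousMap.mul_apply, hp]
    simp only [polyEval, MvPolynomial.aeval_X, map_mul, MvPolynomial.eval_X]
    rfl

theorem polyEval_range (d : ℕ) : (polyEval d).range = polyAlg d := by
  rw [polyEval, ← Algebra.adjoin_range_eq_range_aeval, polyAlg]
  congr 1
  ext f
  simp [eq_comm]

theorem polyEval_mem {d : ℕ} (p : MvPolynomial (Fin d) ℂ) : polyEval d p ∈ ballAlgSub d := by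
  apply Subalgebra.le_topologicalClosure
  rw [← polyEval_range]
  exact ⟨p, rfl⟩

theorem exists_polyEval_near {d : ℕ} {φ : C(CB d, ℂ)} (hφ : φ ∈ ballAlgSub d) {δ : ℝ}
    (hδ : 0 < δ) : ∃ p, ‖φ - polyEval d p‖ < δ := by
  have h : φ ∈ closure (polyAlg d : Set C(CB d, ℂ)) := hφ
  obtain ⟨q, hq, h⟩ := Metric.mem_closure_iff.1 h δ hδ
  rw [SetLike.mem_coe, ← polyEval_range] at hq
  obtain ⟨p, rfl⟩ := hq
  exact ⟨p, by rwa [← dist_eq_norm]⟩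

theorem MvPolynomial.differentiable_eval_euclidean {d : ℕ} (p : MvPolynomial (Fin d) ℂ) :
    Differentiable ℂ fun z : EuclideanSpace ℂ (Fin d) => MvPolynomial.eval (fun i => z i) p := by
  induction p using MvPolynomial.induction_on with
  | C a => simp
  | add p q hp hq => simpa using! hp.add hq
  | mul_X p i hp =>
    simp only [map_mul, MvPolynomial.eval_X]
    exact hp.mul (EuclideanSpace.proj (𝕜 := ℂ) i).differentiable

theorem MvPolynomial.hasDerivAt_eval_line {d : ℕ} (p : MvPolynomial (Fin d) ℂ)
    (z v : Fin d → ℂ) (s : ℂ) :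
    HasDerivAt (fun ζ : ℂ => MvPolynomial.eval (fun i => z i + ζ * v i) p)
      (∑ j, v j * MvPolynomial.eval (fun i => z i + s * v i) (MvPolynomial.pderiv j p)) s := by
  induction p using MvPolynomial.induction_on with
  | C a => simpa using! hasDerivAt_const s a
  | add p q hp hq => simpa [mul_add, Finset.sum_add_distrib] using! hp.add hq
  | mul_X p i hp =>
    have h := hp.mul (((hasDerivAt_id s).mul_const (v i)).const_add (z i))
    refine (h.congr_of_eventuallyEq (.of_forall fun ζ => ?_)).congr_deriv ?_
    · simp
    simp only [Derivation.leibniz, MvPolynomial.pderiv_X, smul_eq_mul, map_add, map_mul,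
      MvPolynomial.eval_X, mul_add, Finset.sum_add_distrib, Finset.sum_mul, id]
    rw [add_comm]
    congr 1
    · rw [Finset.sum_eq_single i]
      · simp
        ring
      · intro j _ hj
        simp [hj.symm]
      · simp
    · rw [← Finset.sum_add_distrib]
      exact Finset.sum_congr rfl fun j _ => by ring

/-- The maximum principle on the closed ball. -/
theorem norm_le_of_le_sphere {d : ℕ} (hd : 1 ≤ d) {f : EuclideanSpace ℂ (Fin d) → ℂ}
    (hf : Differentiable ℂ f) {C : ℝ}
    (hC : ∀ z, ‖z‖ = 1 → ‖f z‖ ≤ C) {z : EuclideanSpace ℂ (Fin d)} (hz : ‖z‖ ≤ 1) :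
    ‖f z‖ ≤ C := by
  have : Nonempty (Fin d) := ⟨⟨0, hd⟩⟩
  apply Complex.norm_le_of_forall_mem_frontier_norm_le (U := ball 0 1) isBounded_ball
    hf.diffContOnCl
  · intro w hw
    rw [frontier_ball _ one_ne_zero] at hw
    exact hC w (by simpa using hw)
  · rw [closure_ball _ one_ne_zero]
    simpa using hz

theorem norm_le_of_le_sphereD {d : ℕ} (hd : 1 ≤ d) (p : MvPolynomial (Fin d) ℂ) {C : ℝ}
    (hC : ∀ z ∈ sphereD d, ‖polyEval d p z‖ ≤ C) (z : CB d) : ‖polyEval d p z‖ ≤ C := by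
  rw [polyEval_apply]
  refine norm_le_of_le_sphere hd p.differentiable_eval_euclidean (fun w hw => ?_)
    (mem_closedBall_zero_iff.1 z.2)
  have := hC ⟨w, by simp [hw]⟩ hw
  rwa [polyEval_apply] at this

theorem le_re_of_le_sphereD {d : ℕ} (hd : 1 ≤ d) (p : MvPolynomial (Fin d) ℂ) {m : ℝ}
    (hC : ∀ z ∈ sphereD d, m ≤ (polyEval d p z).re) (z : CB d) : m ≤ (polyEval d p z).re := by
  have := norm_le_of_le_sphere hd (C := Real.exp (-m))
    (f := fun z => Complex.exp (-MvPolynomial.eval (fun i => z i) p))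
    (p.differentiable_eval_euclidean.neg.cexp) (fun w hw => ?_) (z := z.1)
    (mem_closedBall_zero_iff.1 z.2)
  · rw [← polyEval_apply, Complex.norm_exp] at this
    simpa using this
  · have := hC ⟨w, by simp [hw]⟩ hw
    rw [polyEval_apply] at this
    simpa [Complex.norm_exp] using this

theorem polyEval_harnack {d : ℕ} (p : MvPolynomial (Fin d) ℂ)
    (hp : ∀ z, 0 ≤ (polyEval d p z).re) {z : CB d} {r : ℝ} (hr0 : 0 < r) (hr : r < 1)
    (hz : ‖z.1‖ ≤ r) :
    ‖polyEval d p z‖ ≤ ‖polyEval d p ⟨0, by simp⟩‖ * (1 + r) / (1 - r) := by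
  have hR : 1 < r⁻¹ := (one_lt_inv₀ hr0).2 hr
  have hd (ζ : ℂ) := p.hasDerivAt_eval_line 0 (fun i => z.1 i) ζ
  simp only [Pi.zero_apply, zero_add] at hd
  have hdiff : Differentiable ℂ fun ζ : ℂ => -MvPolynomial.eval (fun i => ζ * z.1 i) p :=
    fun ζ => (hd ζ).differentiableAt.neg
  have key (M : ℝ) (hM : 0 < M) := Complex.borelCaratheodory (z := 1) hM
    (hdiff.differentiableOn (s := ball 0 r⁻¹)) ?_ (by positivity) (by simpa using hR)
  · simp only [norm_neg, one_mul, norm_one, mul_one, zero_mul] at key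
    rw [polyEval_apply, polyEval_apply]
    have hlim : Tendsto (fun M : ℝ => 2 * M / (r⁻¹ - 1) +
        ‖MvPolynomial.eval (fun _ => 0) p‖ * (r⁻¹ + 1) / (r⁻¹ - 1)) (𝓝[>] 0)
        (𝓝 (2 * 0 / (r⁻¹ - 1) +
          ‖MvPolynomial.eval (fun _ => 0) p‖ * (r⁻¹ + 1) / (r⁻¹ - 1))) :=
      (Continuous.tendsto (by fun_prop) 0).mono_left nhdsWithin_le_nhds
    have := ge_of_tendsto hlim (eventually_nhdsWithin_of_forall fun M hM => key M hM)
    refine this.trans (le_of_eq ?_)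
    have : r⁻¹ - 1 ≠ 0 := by linarith
    have : 1 - r ≠ 0 := by linarith
    simp
    field_simp
  · intro ζ hζ
    have hζ : ‖ζ‖ < r⁻¹ := by simpa using hζ
    have hm : ‖ζ • z.1‖ ≤ 1 := by
      rw [norm_smul]
      calc ‖ζ‖ * ‖z.1‖ ≤ r⁻¹ * r := by gcongr
        _ = 1 := inv_mul_cancel₀ hr0.ne'
    have := hp ⟨ζ • z.1, by simpa using hm⟩
    rw [polyEval_apply] at this
    simp at this
    simp
    linarith

@[simp]
theorem polyEval_C_apply {d : ℕ} (a : ℂ) (z : CB d) : polyEval d (MvPolynomial.C a) z = a := by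
  simp

/-- The centre of the closed ball. -/
def ballZero (d : ℕ) : CB d := ⟨0, by simp⟩

/-- The real part of a polynomial function. -/
def polyRe {d : ℕ} (p : MvPolynomial (Fin d) ℂ) : C(CB d, ℝ) :=
  ⟨fun z => (polyEval d p z).re, by fun_prop⟩

/-- If polynomials with nonnegative real part which are large on `K` cannot be small at the centre,
then evaluation of the real part at the centre extends to a positive functional charging `K`. -/
theorem exists_functional_charging {d : ℕ} (hd : 1 ≤ d) {K : Set (CB d)} (hK : K ⊆ sphereD d)
    {ε : ℝ}
    (h : ∀ p : MvPolynomial (Fin d) ℂ, (∀ z ∈ sphereD d, 0 ≤ (polyEval d p z).re) →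
      (∀ z ∈ K, 1 ≤ (polyEval d p z).re) → ε ≤ (polyEval d p (ballZero d)).re) :
    ∃ L : C(CB d, ℝ) →ₗ[ℝ] ℝ, (∀ v, (∀ z ∈ sphereD d, v z ≤ 0) → L v ≤ 0) ∧
      (∀ p, L (polyRe p) = (polyEval d p (ballZero d)).re) ∧
      ∀ u, (∀ z ∈ sphereD d, 0 ≤ u z) → (∀ z ∈ K, 1 ≤ u z) → ε ≤ L u := by
  let T (v : C(CB d, ℝ)) : Set ℝ := {t | ∃ (p : MvPolynomial (Fin d) ℂ) (c : ℝ), 0 ≤ c ∧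
    (∀ z ∈ sphereD d, v z ≤ (polyEval d p z).re) ∧ (∀ z ∈ K, v z + c ≤ (polyEval d p z).re) ∧
    t = (polyEval d p (ballZero d)).re - ε * c}
  have hlow (v : C(CB d, ℝ)) : ∀ t ∈ T v, -‖v‖ ≤ t := by
    rintro t ⟨p, c, hc, h1, h2, rfl⟩
    have hv (z : CB d) : -‖v‖ ≤ v z := (abs_le.1 (v.norm_coe_le_norm z)).1
    rcases hc.eq_or_lt with rfl | hc
    · have := le_re_of_le_sphereD hd p (m := -‖v‖)
        (fun z hz => (hv z).trans (h1 z hz)) (ballZero d)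
      simpa using this
    · have := h (MvPolynomial.C ((c⁻¹ : ℝ) : ℂ) * (p + MvPolynomial.C (‖v‖ : ℂ))) ?_ ?_
      · simp only [map_mul, map_add, ContinuousMap.mul_apply, ContinuousMap.add_apply,
          polyEval_C_apply, Complex.re_ofReal_mul,
          Complex.add_re, Complex.ofReal_re] at this ⊢
        rw [inv_mul_eq_div, le_div_iff₀ hc] at this
        linarith
      · intro z hz
        have h1 := h1 z hz
        have := hv z
        simp only [map_mul, map_add, ContinuousMap.mul_apply, ContinuousMap.add_apply,
          polyEval_C_apply, Complex.re_ofReal_mul,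
          Complex.add_re, Complex.ofReal_re] at h1 ⊢
        apply mul_nonneg (by positivity)
        linarith
      · intro z hz
        have h2 := h2 z hz
        have := hv z
        simp only [map_mul, map_add, ContinuousMap.mul_apply, ContinuousMap.add_apply,
          polyEval_C_apply, Complex.re_ofReal_mul,
          Complex.add_re, Complex.ofReal_re] at h2 ⊢
        rw [inv_mul_eq_div, le_div_iff₀ hc]
        linarith
  have hbdd (v) : BddBelow (T v) := ⟨_, hlow v⟩
  have hne (v) : (T v).Nonempty := by
    have hv (z : CB d) : v z ≤ ‖v‖ := (abs_le.1 (v.norm_coe_le_norm z)).2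
    refine ⟨_, MvPolynomial.C (‖v‖ : ℂ), 0, le_rfl, fun z _ => ?_, fun z _ => ?_, rfl⟩ <;>
    simpa [polyEval_apply] using hv z
  have hsmul (v) (a : ℝ) (ha : 0 < a) : sInf (T (a • v)) ≤ a * sInf (T v) := by
    rw [← div_le_iff₀' ha]
    refine le_csInf (hne v) ?_
    rintro t ⟨p, c, hc, h1, h2, rfl⟩
    rw [div_le_iff₀' ha]
    refine csInf_le (hbdd _) ⟨MvPolynomial.C (a : ℂ) * p, a * c, by positivity,
      fun z hz => ?_, fun z hz => ?_, ?_⟩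
    · have := mul_le_mul_of_nonneg_left (h1 z hz) ha.le
      simpa [polyEval_apply] using this
    · have := mul_le_mul_of_nonneg_left (h2 z hz) ha.le
      simpa [polyEval_apply, mul_add] using this
    · simp only [map_mul, ContinuousMap.mul_apply, polyEval_C_apply, Complex.re_ofReal_mul]
      ring
  have hN : ∃ L : C(CB d, ℝ) →ₗ[ℝ] ℝ,
      (∀ x : (⊥ : C(CB d, ℝ) →ₗ.[ℝ] ℝ).domain, L x = (⊥ : C(CB d, ℝ) →ₗ.[ℝ] ℝ) x) ∧
      ∀ v, L v ≤ sInf (T v) := by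
    refine exists_extension_of_le_sublinear _ _
      (fun a ha v => (hsmul v a ha).antisymm ?_) (fun v w => ?_) (fun x => ?_)
    · have := hsmul (a • v) a⁻¹ (inv_pos.2 ha)
      rw [smul_smul, inv_mul_cancel₀ ha.ne', one_smul, inv_mul_eq_div, le_div_iff₀' ha] at this
      exact this
    · rw [← sub_le_iff_le_add]
      refine le_csInf (hne v) ?_
      rintro t ⟨p, c, hc, h1, h2, rfl⟩
      rw [sub_le_comm]
      refine le_csInf (hne w) ?_
      rintro t ⟨p', c', hc', h1', h2', rfl⟩
      rw [sub_le_iff_le_add]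
      refine csInf_le (hbdd _) ⟨p + p', c + c', by positivity, fun z hz => ?_, fun z hz => ?_, ?_⟩
      · simpa using add_le_add (h1 z hz) (h1' z hz)
      · have := add_le_add (h2 z hz) (h2' z hz)
        simp only [map_add, ContinuousMap.add_apply, Complex.add_re]
        linarith
      · simp only [map_add, ContinuousMap.add_apply, Complex.add_re]
        ring
    · obtain ⟨x, hx⟩ := x
      have hx : x = 0 := (Submodule.mem_bot ℝ).1 hx
      subst hx
      have e : (⟨0, hx⟩ : (⊥ : C(CB d, ℝ) →ₗ.[ℝ] ℝ).domain) = 0 := rfl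
      rw [e, LinearPMap.map_zero]
      refine le_csInf (hne _) fun t ht => ?_
      simpa using hlow _ t ht
  obtain ⟨L, -, hL⟩ := hN
  have hLT (v) (t) (ht : t ∈ T v) : L v ≤ t := (hL v).trans (csInf_le (hbdd v) ht)
  have hle (p) : L (polyRe p) ≤ (polyEval d p (ballZero d)).re :=
    hLT _ _ ⟨p, 0, le_rfl, fun z _ => le_rfl, fun z _ => by simp [polyRe], by simp⟩
  refine ⟨L, fun v hv => ?_, fun p => (hle p).antisymm ?_, fun u hu hu1 => ?_⟩
  · refine hLT v 0 ⟨0, 0, le_rfl, fun z hz => ?_, fun z hz => ?_, by simp⟩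
    · simpa using hv z hz
    · simpa using hv z (hK hz)
  · have := hle (-p)
    have e : polyRe (-p) = -polyRe p := by ext z; simp [polyRe]
    rw [e, map_neg] at this
    simpa using this
  · have := hLT (-u) (-ε) ⟨0, 1, zero_le_one, fun z hz => ?_, fun z hz => ?_, by simp⟩
    · rw [map_neg] at this
      linarith
    · simpa using hu z hz
    · simpa using hu1 z hz

/-- A functional as in `exists_functional_charging` is integration against a Henkin measure
charging `K`. -/
theorem exists_henkin_of_functional {d : ℕ} {K : Set (CB d)} (hKc : IsClosed K) {ε : ℝ}
    (hε : 0 < ε) (L : C(CB d, ℝ) →ₗ[ℝ] ℝ)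
    (hpos : ∀ v, (∀ z ∈ sphereD d, v z ≤ 0) → L v ≤ 0)
    (hL : ∀ p, L (polyRe p) = (polyEval d p (ballZero d)).re)
    (hLK : ∀ u : C(CB d, ℝ), (∀ z ∈ sphereD d, 0 ≤ u z) → (∀ z ∈ K, 1 ≤ u z) → ε ≤ L u) :
    ∃ μ : Measure (CB d), IsHenkin d μ ∧ μ K ≠ 0 := by
  let Λ : CompactlySupportedContinuousMap (CB d) ℝ →ₚ[ℝ] ℝ :=
    { toFun := fun g => L g.toContinuousMap
      map_add' := fun f g => L.map_add _ _
      map_smul' := fun c f => L.map_smul c _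
      monotone' := fun f g hfg => by
        have := hpos (f.toContinuousMap - g.toContinuousMap) fun z _ => sub_nonpos.2 (hfg z)
        rw [map_sub] at this
        simpa using this }
  let μ := RealRMK.rieszMeasure Λ
  have hreg : μ.Regular := RealRMK.regular_rieszMeasure Λ
  have hfin : IsFiniteMeasure μ := inferInstance
  have h_int (v : C(CB d, ℝ)) : ∫ z, v z ∂μ = L v :=
    RealRMK.integral_rieszMeasure Λ ⟨v, .of_compactSpace v⟩
  have hsphere : μ (sphereD d)ᶜ = 0 := by
    let v : C(CB d, ℝ) := ⟨fun z => 1 - ‖z.1‖, by fun_prop⟩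
    have hv0 : ∀ z, 0 ≤ v z := fun z => sub_nonneg.2 (mem_closedBall_zero_iff.1 z.2)
    have hz : ∫ z, v z ∂μ = 0 := by
      rw [h_int]
      refine le_antisymm (hpos v fun z hz => ?_) ?_
      · have : ‖z.1‖ = 1 := hz
        simp [v, this]
      · have := hpos (-v) fun z hz => by simpa using hv0 z
        rw [map_neg] at this
        linarith
    rw [integral_eq_zero_iff_of_nonneg hv0 (v.continuous.integrable_of_hasCompactSupport
      (.of_compactSpace v))] at hz
    rw [← mem_ae_iff]
    filter_upwards [hz] with z hz
    have : 1 - ‖z.1‖ = 0 := hz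
    show ‖z.1‖ = 1
    linarith
  have hcint (f : C(CB d, ℂ)) : Integrable f μ :=
    f.continuous.integrable_of_hasCompactSupport (.of_compactSpace f)
  have hre (p) : ∫ z, (polyEval d p z).re ∂μ = (polyEval d p (ballZero d)).re :=
    (h_int (polyRe p)).trans (hL p)
  have hpoly (p) : ∫ z, polyEval d p z ∂μ = polyEval d p (ballZero d) := by
    apply Complex.ext
    · rw [← hre]
      exact (integral_re (hcint _)).symm
    · have := hre (MvPolynomial.C (-Complex.I) * p)
      simp only [map_mul, ContinuousMap.mul_apply, polyEval_C_apply, Complex.mul_re, Complex.neg_re,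
        Complex.I_re, Complex.I_im,
        zero_mul, zero_sub, neg_mul, one_mul, neg_neg] at this
      rw [← this]
      exact (integral_im (hcint _)).symm
  have hball (φ) (hφ : φ ∈ ballAlgSub d) : ∫ z, φ z ∂μ = φ (ballZero d) := by
    have hc : IsClosed {φ : C(CB d, ℂ) | ∫ z, φ z ∂μ = φ (ballZero d)} := by
      refine isClosed_eq (LipschitzWith.of_dist_le_mul (K := (μ.real univ).toNNReal)
        fun f g => ?_).continuous (by fun_prop)
      rw [dist_eq_norm, dist_eq_norm, ← integral_sub (hcint f) (hcint g),
        Real.coe_toNNReal _ measureReal_nonneg, mul_comm]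
      exact norm_integral_le_of_norm_le_const (.of_forall fun z => (f - g).norm_coe_le_norm z)
    refine closure_minimal ?_ hc hφ
    intro q hq
    rw [SetLike.mem_coe, ← polyEval_range] at hq
    obtain ⟨p, rfl⟩ := hq
    exact hpoly p
  refine ⟨μ, ⟨hfin, hreg, hsphere, fun f hf _ hlim => ?_⟩, fun hμK => ?_⟩
  · simp_rw [fun n => hball (f n) (hf n)]
    exact hlim (ballZero d) (by simp [openD, ballZero])
  · obtain ⟨U, hKU, hU, hμU⟩ := K.exists_isOpen_lt_of_lt (μ := μ) (ENNReal.ofReal ε)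
      (by rw [hμK]; simpa using hε)
    obtain ⟨u, hu0, hu1, hu⟩ := exists_continuous_zero_one_of_isClosed hU.isClosed_compl hKc
      (disjoint_compl_left_iff_subset.2 hKU)
    have h1 := hLK u (fun z _ => (hu z).1) (fun z hz => (hu1 hz).ge)
    rw [← h_int] at h1
    have h2 : ∫ z, u z ∂μ ≤ ∫ z, U.indicator 1 z ∂μ := by
      refine integral_mono (u.continuous.integrable_of_hasCompactSupport (.of_compactSpace u))
        ((integrable_const 1).indicator hU.measurableSet) fun z => ?_
      by_cases hz : z ∈ U
      · simpa [hz] using (hu z).2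
      · simpa [hz] using (hu0 hz).le
    rw [integral_indicator_one hU.measurableSet] at h2
    have h3 : μ.real U < ε := by
      rw [Measure.real]
      exact (ENNReal.lt_ofReal_iff_toReal_lt hμU.ne_top).1 hμU
    linarith

theorem exists_poly_of_totallyNull {d : ℕ} (hd : 1 ≤ d) {K : Set (CB d)} (hKc : IsClosed K)
    (hTN : IsTotallyNull d K) {ε : ℝ} (hε : 0 < ε) :
    ∃ p : MvPolynomial (Fin d) ℂ, (∀ z, 0 ≤ (polyEval d p z).re) ∧
      (∀ z ∈ K, 1 ≤ (polyEval d p z).re) ∧ ‖polyEval d p (ballZero d)‖ < ε := by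
  by_contra! H
  obtain ⟨L, h1, h2, h3⟩ := exists_functional_charging hd hTN.1 (ε := ε) fun p hp hpK => by
    have key (z) : (polyEval d (p - MvPolynomial.C ((polyEval d p (ballZero d)).im * Complex.I))
        z).re = (polyEval d p z).re := by simp
    have h0 : polyEval d (p - MvPolynomial.C ((polyEval d p (ballZero d)).im * Complex.I))
        (ballZero d) = ((polyEval d p (ballZero d)).re : ℂ) := by
      apply Complex.ext <;> simp
    have hp' := le_re_of_le_sphereD hd p hp
    have := H (p - MvPolynomial.C ((polyEval d p (ballZero d)).im * Complex.I))
      (fun z => (hp' z).trans_eq (key z).symm) fun z hz => (hpK z hz).trans_eq (key z).symm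
    rwa [h0, Complex.norm_real, Real.norm_of_nonneg (hp' _)] at this
  obtain ⟨μ, hμ, hμK⟩ := exists_henkin_of_functional hKc hε L h1 h2 h3
  exact hμK (hTN.2 μ hμ)

/-- Functions of the ball algebra of the form `1 + f` with `0 ≤ Re f` are invertible. -/
theorem exists_inverse_one_add {d : ℕ} {f : C(CB d, ℂ)} (hf : f ∈ ballAlgSub d)
    (hre : ∀ z, 0 ≤ (f z).re) : ∃ g ∈ ballAlgSub d, ∀ z, g z = (1 + f z)⁻¹ := by
  have hcl : IsClosed (ballAlgSub d : Set C(CB d, ℂ)) := Subalgebra.isClosed_topologicalClosure _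
  have : CompleteSpace (ballAlgSub d) := hcl.completeSpace_coe
  set c : ℝ := ‖f‖ ^ 2 with hc
  have hc0 : 0 ≤ c := sq_nonneg _
  have hc1 : (1 + c : ℂ) ≠ 0 := by
    exact_mod_cast (by positivity : (1 + c : ℝ) ≠ 0)
  let a : ballAlgSub d := (1 + c : ℂ)⁻¹ • (algebraMap ℂ _ (c : ℂ) - ⟨f, hf⟩)
  have ha (z : CB d) : (a : C(CB d, ℂ)) z = (1 + c : ℂ)⁻¹ * (c - f z) := rfl
  have hna : ‖a‖ < 1 := by
    refine lt_of_le_of_lt (b := √(c ^ 2 + c) / (1 + c)) ?_ ?_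
    · change ‖(a : C(CB d, ℂ))‖ ≤ _
      refine (ContinuousMap.norm_le _ (by positivity)).2 fun z => ?_
      rw [ha, norm_mul, norm_inv, inv_mul_eq_div]
      have e : ‖(1 + c : ℂ)‖ = 1 + c := by
        rw [← Complex.ofReal_one, ← Complex.ofReal_add, Complex.norm_real,
          Real.norm_of_nonneg (by positivity)]
      rw [e]
      gcongr
      apply Real.le_sqrt_of_sq_le
      have h1 : ‖f z‖ ^ 2 ≤ c := by
        rw [hc]
        gcongr
        exact f.norm_coe_le_norm z
      rw [← Complex.normSq_eq_norm_sq, Complex.normSq_apply] at h1 ⊢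
      simp only [Complex.sub_re, Complex.sub_im, Complex.ofReal_re, Complex.ofReal_im]
      nlinarith [mul_nonneg hc0 (hre z)]
    · rw [div_lt_one (by positivity), Real.sqrt_lt' (by positivity)]
      nlinarith
  let u := Units.oneSub a hna
  let b : ballAlgSub d := ((u⁻¹ : (ballAlgSub d)ˣ) : ballAlgSub d)
  have hub : (1 - a) * b = 1 := u.mul_inv
  refine ⟨((1 + c : ℂ)⁻¹ • b : ballAlgSub d), Subtype.prop _, fun z => ?_⟩
  have h : (1 - (a : C(CB d, ℂ)) z) * (b : C(CB d, ℂ)) z = 1 :=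
    congrArg (fun x : ballAlgSub d => (x : C(CB d, ℂ)) z) hub
  rw [ha] at h
  change (1 + c : ℂ)⁻¹ * (b : C(CB d, ℂ)) z = _
  apply eq_inv_of_mul_eq_one_left
  have e (x : ℂ) : (1 - (1 + c : ℂ)⁻¹ * (c - f z)) * x = (1 + c : ℂ)⁻¹ * x * (1 + f z) := by
    field_simp
    ring
  exact (e _).symm.trans h

theorem Complex.one_add_sq_norm_le {w : ℂ} (hw : 0 ≤ w.re) : 1 + ‖w‖ ^ 2 ≤ ‖1 + w‖ ^ 2 := by
  simp only [← Complex.normSq_eq_norm_sq, Complex.normSq_apply, Complex.add_re, Complex.add_im,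
    Complex.one_re, Complex.one_im]
  nlinarith

theorem Complex.norm_inv_add_norm_sub_le {w : ℂ} (hw : 0 ≤ w.re) :
    ‖(1 + w)⁻¹‖ + ‖1 - (1 + w)⁻¹‖ ≤
      1 + 16 / 3 * (4 * ‖w‖ / (1 + 4 * ‖w‖) - ‖w‖ / (1 + ‖w‖)) := by
  have hA := Complex.one_add_sq_norm_le hw
  have hne : 1 + w ≠ 0 := by
    intro h
    rw [h, norm_zero] at hA
    nlinarith [sq_nonneg ‖w‖]
  have e : 1 - (1 + w)⁻¹ = w / (1 + w) := by
    field_simp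
    ring
  rw [e, norm_div, norm_inv]
  have hA0 : 0 < ‖1 + w‖ := norm_pos_iff.2 hne
  have hy : 0 ≤ ‖w‖ := norm_nonneg w
  generalize ‖1 + w‖ = A at *
  generalize ‖w‖ = y at *
  have h1 : 1 + 4 * y / (1 + y) ^ 2 ≤ 1 + 16 / 3 * (4 * y / (1 + 4 * y) - y / (1 + y)) := by
    have : 16 / 3 * (4 * y / (1 + 4 * y) - y / (1 + y)) = 16 * y / ((1 + 4 * y) * (1 + y)) := by
      field_simp
      ring
    rw [this, add_le_add_iff_left, div_le_div_iff₀ (by positivity) (by positivity)]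
    have : 0 ≤ y * (1 + y) := by positivity
    nlinarith
  refine le_trans ?_ h1
  have h2 : A⁻¹ + y / A = (1 + y) / A := by
    field_simp
  rw [h2, div_le_iff₀ hA0]
  apply (sq_le_sq₀ (by positivity) (by positivity)).1
  rw [mul_pow]
  have e : 1 + 4 * y / (1 + y) ^ 2 = ((1 + y) ^ 2 + 4 * y) / (1 + y) ^ 2 := by
    field_simp
  calc (1 + y) ^ 2 ≤ (1 + 4 * y / (1 + y) ^ 2) ^ 2 * (1 + y ^ 2) := by
        rw [e, div_pow, div_mul_eq_mul_div, le_div_iff₀ (by positivity)]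
        have h3 : 0 ≤ y ^ 2 * (6 * (1 + y) ^ 4 - 32 * y) := by
          apply mul_nonneg (by positivity)
          nlinarith [sq_nonneg (y - 1), sq_nonneg (y ^ 2), mul_nonneg hy hy,
            mul_nonneg hy (mul_nonneg hy hy), sq_nonneg (6 * y - 1)]
        have h4 : 0 ≤ (6 * (1 + y) ^ 4 * y ^ 2 - 32 * y ^ 3) := by linarith
        nlinarith
    _ ≤ _ := by gcongr

/-- A function of the ball algebra close to `1` where `Re f` is large, small where `f` is small,
and taking values close to the segment `[0, 1]`. -/
theorem exists_thin {d : ℕ} {f : C(CB d, ℂ)} (hf : f ∈ ballAlgSub d)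
    (hre : ∀ z, 0 ≤ (f z).re) {N : ℕ} (hN : 0 < N) :
    ∃ g ∈ ballAlgSub d, ∀ z, ‖g z‖ + ‖1 - g z‖ ≤ 1 + 6 / N ∧ ‖g z‖ ≤ 4 ^ N * ‖f z‖ ∧
      ∀ m : ℝ, 0 < m → m ≤ (f z).re → ‖1 - g z‖ ≤ 1 / m := by
  have hex (j : ℕ) : ∃ g ∈ ballAlgSub d, ∀ z, g z = (1 + 4 ^ j * f z)⁻¹ := by
    refine exists_inverse_one_add (f := (4 ^ j : ℂ) • f) (Subalgebra.smul_mem _ hf _) fun z => ?_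
    have := Complex.re_ofReal_mul (4 ^ j) (f z)
    push_cast at this
    rw [ContinuousMap.smul_apply, smul_eq_mul, this]
    exact mul_nonneg (by positivity) (hre z)
  choose g hg hgz using hex
  have hN' : (0 : ℝ) < N := by exact_mod_cast hN
  have hNc : (N : ℂ) ≠ 0 := by exact_mod_cast hN.ne'
  have hwre (j : ℕ) (z) : (4 ^ j * f z).re = 4 ^ j * (f z).re := by
    have := Complex.re_ofReal_mul (4 ^ j) (f z)
    push_cast at this
    exact this
  have hw (j : ℕ) (z) : 0 ≤ (4 ^ j * f z).re := by
    rw [hwre]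
    exact mul_nonneg (by positivity) (hre z)
  refine ⟨1 - (N : ℂ)⁻¹ • ∑ j ∈ Finset.range N, g j, Subalgebra.sub_mem _ (Subalgebra.one_mem _)
    (Subalgebra.smul_mem _ (Subalgebra.sum_mem _ fun j _ => hg j) _), fun z => ?_⟩
  have e1 : (1 - (N : ℂ)⁻¹ • ∑ j ∈ Finset.range N, g j) z =
      (N : ℂ)⁻¹ * ∑ j ∈ Finset.range N, (1 - (1 + 4 ^ j * f z)⁻¹) := by
    simp [hgz, mul_sub, hNc]
  have e2 : 1 - (1 - (N : ℂ)⁻¹ • ∑ j ∈ Finset.range N, g j) z =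
      (N : ℂ)⁻¹ * ∑ j ∈ Finset.range N, (1 + 4 ^ j * f z)⁻¹ := by
    simp [hgz]
  rw [e2, e1]
  have hb (a : ℕ → ℂ) : ‖(N : ℂ)⁻¹ * ∑ j ∈ Finset.range N, a j‖ ≤
      (∑ j ∈ Finset.range N, ‖a j‖) / N := by
    rw [norm_mul, norm_inv, Complex.norm_natCast, inv_mul_eq_div]
    gcongr
    exact norm_sum_le _ _
  have hA (j : ℕ) := Complex.one_add_sq_norm_le (hw j z)
  have hbc (a : ℕ → ℂ) (C : ℝ) (h : ∀ j ∈ Finset.range N, ‖a j‖ ≤ C) :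
      ‖(N : ℂ)⁻¹ * ∑ j ∈ Finset.range N, a j‖ ≤ C := by
    refine (hb a).trans ?_
    rw [div_le_iff₀ hN', mul_comm]
    simpa using Finset.sum_le_card_nsmul _ _ _ h
  refine ⟨?_, ?_, fun m hm hmf => ?_⟩
  · refine (add_le_add (hb _) (hb _)).trans ?_
    rw [← add_div, ← Finset.sum_add_distrib, div_le_iff₀ hN', add_mul, div_mul_cancel₀ _ hN'.ne',
      one_mul]
    let Ψ (j : ℕ) : ℝ := ‖4 ^ j * f z‖ / (1 + ‖4 ^ j * f z‖)
    calc _ ≤ ∑ j ∈ Finset.range N, (1 + 16 / 3 * (Ψ (j + 1) - Ψ j)) := by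
          refine Finset.sum_le_sum fun j _ => ?_
          have e : ‖4 ^ (j + 1) * f z‖ = 4 * ‖4 ^ j * f z‖ := by
            rw [pow_succ', mul_assoc, norm_mul]
            simp
          simp only [Ψ, e]
          rw [add_comm]
          exact Complex.norm_inv_add_norm_sub_le (hw j z)
      _ = N + 16 / 3 * (Ψ N - Ψ 0) := by
          rw [Finset.sum_add_distrib, ← Finset.mul_sum, Finset.sum_range_sub]
          simp
      _ ≤ N + 6 := by
          have h1 : Ψ N ≤ 1 := div_le_one_of_le₀ (by linarith) (by positivity)
          have h0 : 0 ≤ Ψ 0 := by positivity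
          linarith
  · refine hbc _ _ fun j hj => ?_
    have hne : 1 + 4 ^ j * f z ≠ 0 := by
      intro h
      have := hA j
      rw [h, norm_zero] at this
      nlinarith [sq_nonneg ‖4 ^ j * f z‖]
    have e : 1 - (1 + 4 ^ j * f z)⁻¹ = 4 ^ j * f z / (1 + 4 ^ j * f z) := by
      field_simp
      ring
    have h1 : 1 ≤ ‖1 + 4 ^ j * f z‖ := by
      nlinarith [hA j, sq_nonneg ‖4 ^ j * f z‖, norm_nonneg (1 + 4 ^ j * f z)]
    rw [e, norm_div]
    refine (div_le_self (norm_nonneg _) h1).trans ?_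
    rw [norm_mul, norm_pow, Complex.norm_ofNat]
    gcongr
    · norm_num
    · exact (Finset.mem_range.1 hj).le
  · refine hbc _ _ fun j _ => ?_
    rw [norm_inv, ← one_div]
    gcongr
    calc m ≤ (4 ^ j * f z).re := by
          rw [hwre]
          have : (1 : ℝ) ≤ 4 ^ j := one_le_pow₀ (by norm_num)
          nlinarith
      _ ≤ (1 + 4 ^ j * f z).re := by simp
      _ ≤ _ := Complex.re_le_norm _

theorem MvPolynomial.exists_eval_eq_integral {d : ℕ} (r : MvPolynomial (Fin d) ℂ) :
    ∃ q : MvPolynomial (Fin d) ℂ, ∀ z : Fin d → ℂ, MvPolynomial.eval z q =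
      ∫ t in (0 : ℝ)..1, MvPolynomial.eval (fun i => (t : ℂ) * z i) r := by
  induction r using MvPolynomial.induction_on' with
  | monomial u a =>
    refine ⟨MvPolynomial.monomial u (a * (∫ t in (0 : ℝ)..1, (t : ℂ) ^ (u.sum fun _ e => e))),
      fun z => ?_⟩
    rw [MvPolynomial.eval_monomial, mul_right_comm, ← intervalIntegral.integral_const_mul]
    congr 1
    ext t
    rw [MvPolynomial.eval_monomial]
    simp only [Finsupp.prod, mul_pow, Finset.prod_mul_distrib, Finset.prod_pow_eq_pow_sum,
      Finsupp.sum]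
    ring
  | add p q hp hq =>
    obtain ⟨p', hp'⟩ := hp
    obtain ⟨q', hq'⟩ := hq
    refine ⟨p' + q', fun z => ?_⟩
    have hc (p : MvPolynomial (Fin d) ℂ) : Continuous fun t : ℝ =>
        MvPolynomial.eval (fun i => (t : ℂ) * z i) p := by
      exact (MvPolynomial.continuous_eval p).comp (by fun_prop)
    rw [map_add, hp', hq', ← intervalIntegral.integral_add ((hc _).intervalIntegrable _ _)
      ((hc _).intervalIntegrable _ _)]
    simp

/-- Cauchy estimate for a polynomial along a complex line. -/
theorem norm_deriv_line_le {d : ℕ} (p : MvPolynomial (Fin d) ℂ) {R δ ρ : ℝ} (hρ : 0 < ρ)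
    (hp : ∀ z : EuclideanSpace ℂ (Fin d), ‖z‖ ≤ R → ‖MvPolynomial.eval (fun i => z i) p‖ ≤ δ)
    (z v : EuclideanSpace ℂ (Fin d)) (hz : ∀ ζ : ℂ, ‖ζ‖ = ρ → ‖z + ζ • v‖ ≤ R) :
    ‖∑ j, v j * MvPolynomial.eval (fun i => z i) (MvPolynomial.pderiv j p)‖ ≤ δ / ρ := by
  have hd := p.hasDerivAt_eval_line (fun i => z i) (fun i => v i)
  have h0 := (hd 0).deriv
  simp only [zero_mul, add_zero] at h0
  rw [← h0]
  refine Complex.norm_deriv_le_of_forall_mem_sphere_norm_le hρ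
    (Differentiable.diffContOnCl fun ζ => (hd ζ).differentiableAt) fun ζ hζ => ?_
  simpa using hp (z + ζ • v) (hz ζ (by simpa using hζ))

/-- The projection of the `i`-th basis vector to the orthogonal complement of a unit vector. -/
def tangentialVector {d : ℕ} (i : Fin d) (z : EuclideanSpace ℂ (Fin d)) :
    EuclideanSpace ℂ (Fin d) :=
  EuclideanSpace.single i 1 - star (z i) • z

theorem norm_add_smul_tangentialVector_le {d : ℕ} (i : Fin d) {z : EuclideanSpace ℂ (Fin d)}
    (hz : ‖z‖ = 1) (t : ℝ) (ζ : ℂ) :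
    ‖(t : ℂ) • z + ζ • tangentialVector i z‖ ^ 2 ≤ t ^ 2 + ‖ζ‖ ^ 2 := by
  have h0 : inner ℂ z (tangentialVector i z) = 0 := by
    rw [tangentialVector, inner_sub_right, inner_smul_right, inner_self_eq_norm_sq_to_K, hz]
    simp [EuclideanSpace.inner_single_right]
  have hv : ‖tangentialVector i z‖ ^ 2 ≤ 1 := by
    have h1 : EuclideanSpace.single i 1 = tangentialVector i z + star (z i) • z := by
      simp [tangentialVector]
    have h2 : ‖(EuclideanSpace.single i 1 : EuclideanSpace ℂ (Fin d))‖ ^ 2 =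
        ‖tangentialVector i z‖ ^ 2 + ‖star (z i) • z‖ ^ 2 := by
      rw [h1, sq, sq, sq]
      apply norm_add_sq_eq_norm_sq_add_norm_sq_of_inner_eq_zero (𝕜 := ℂ)
      rw [inner_smul_right, inner_eq_zero_symm.1 h0, mul_zero]
    have h3 : ‖(EuclideanSpace.single i 1 : EuclideanSpace ℂ (Fin d))‖ = 1 := by simp
    rw [h3] at h2
    nlinarith [sq_nonneg ‖star (z i) • z‖]
  have h4 : ‖(t : ℂ) • z + ζ • tangentialVector i z‖ ^ 2 =
      ‖(t : ℂ) • z‖ ^ 2 + ‖ζ • tangentialVector i z‖ ^ 2 := by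
    rw [sq, sq, sq]
    apply norm_add_sq_eq_norm_sq_add_norm_sq_of_inner_eq_zero (𝕜 := ℂ)
    rw [inner_smul_left, inner_smul_right, h0]
    simp
  rw [h4, norm_smul, norm_smul, mul_pow, mul_pow, hz]
  simp only [Complex.norm_real, Real.norm_eq_abs, sq_abs, one_pow, mul_one]
  nlinarith [sq_nonneg ‖ζ‖]

/-- The tangential derivative controls the difference between multiplication by a conjugate
coordinate and the division operator. -/
theorem conj_mul_sub_eq_integral {d : ℕ} (i : Fin d) (p q : MvPolynomial (Fin d) ℂ)
    (hq : ∀ z : Fin d → ℂ, MvPolynomial.eval z q =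
      ∫ t in (0 : ℝ)..1, MvPolynomial.eval (fun i => (t : ℂ) * z i) (MvPolynomial.pderiv i p))
    (z : EuclideanSpace ℂ (Fin d)) :
    star (z i) * (MvPolynomial.eval (fun i => z i) p - MvPolynomial.eval (fun _ => 0) p) -
      MvPolynomial.eval (fun i => z i) q = -∫ t in (0 : ℝ)..1, ∑ j, tangentialVector i z j *
        MvPolynomial.eval (fun i => ((t : ℂ) • z) i) (MvPolynomial.pderiv j p) := by
  have hc (p : MvPolynomial (Fin d) ℂ) : Continuous fun t : ℝ =>
      MvPolynomial.eval (fun i => (t : ℂ) * z i) p := by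
    exact (MvPolynomial.continuous_eval p).comp (by fun_prop)
  have hftc : MvPolynomial.eval (fun i => z i) p - MvPolynomial.eval (fun _ => 0) p =
      ∫ t in (0 : ℝ)..1, ∑ j, z j *
        MvPolynomial.eval (fun i => (t : ℂ) * z i) (MvPolynomial.pderiv j p) := by
    rw [intervalIntegral.integral_eq_sub_of_hasDerivAt
      (f := fun t : ℝ => MvPolynomial.eval (fun i => (t : ℂ) * z i) p)]
    · simp
    · intro t _
      have := (p.hasDerivAt_eval_line 0 (fun i => z i) t).comp_ofReal
      simpa using this
    · exact (continuous_finsetSum _ fun j _ => (hc _).const_mul _).intervalIntegrable _ _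
  rw [hftc, hq, ← intervalIntegral.integral_const_mul, ← intervalIntegral.integral_neg,
    ← intervalIntegral.integral_sub]
  · congr 1
    ext t
    simp only [tangentialVector, PiLp.sub_apply, PiLp.smul_apply, smul_eq_mul, sub_mul,
      Finset.sum_sub_distrib, neg_sub]
    congr 1
    · rw [Finset.mul_sum]
      exact Finset.sum_congr rfl fun j _ => by ring
    · rw [Finset.sum_eq_single i] <;> simp +contextual
  · exact (continuous_const.mul (continuous_finsetSum _
      fun j _ => (hc _).const_mul _)).intervalIntegrable _ _
  · exact (hc _).intervalIntegrable _ _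

theorem norm_conj_mul_sub_le {d : ℕ} (i : Fin d) (p q : MvPolynomial (Fin d) ℂ)
    (hq : ∀ z : Fin d → ℂ, MvPolynomial.eval z q =
      ∫ t in (0 : ℝ)..1, MvPolynomial.eval (fun i => (t : ℂ) * z i) (MvPolynomial.pderiv i p))
    {M δ R s : ℝ} (hR : 0 < R) (hs : 0 < s) (hRs : R ^ 2 + s ^ 2 = 1)
    (hM : ∀ z : EuclideanSpace ℂ (Fin d), ‖z‖ ≤ 1 → ‖MvPolynomial.eval (fun i => z i) p‖ ≤ M)
    (hδ : ∀ z : EuclideanSpace ℂ (Fin d), ‖z‖ ≤ R → ‖MvPolynomial.eval (fun i => z i) p‖ ≤ δ)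
    {z : EuclideanSpace ℂ (Fin d)} (hz : ‖z‖ = 1) :
    ‖star (z i) * MvPolynomial.eval (fun i => z i) p - MvPolynomial.eval (fun i => z i) q‖ ≤
      δ + (δ / (R * s) + 2 * M * s) := by
  have hzi : ‖z i‖ ≤ 1 := hz ▸ PiLp.norm_apply_le z i
  have h0 : ‖MvPolynomial.eval (fun _ => (0 : ℂ)) p‖ ≤ δ := by
    simpa using hδ 0 (by simpa using hR.le)
  have hδ0 : 0 ≤ δ := (norm_nonneg _).trans h0
  have hM0 : 0 ≤ M := (norm_nonneg _).trans (hM 0 (by simp))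
  have e : star (z i) * MvPolynomial.eval (fun i => z i) p - MvPolynomial.eval (fun i => z i) q =
      star (z i) * MvPolynomial.eval (fun _ => (0 : ℂ)) p + (star (z i) *
        (MvPolynomial.eval (fun i => z i) p - MvPolynomial.eval (fun _ => 0) p) -
          MvPolynomial.eval (fun i => z i) q) := by ring
  rw [e, conj_mul_sub_eq_integral i p q hq]
  refine (norm_add_le _ _).trans (add_le_add ?_ ?_)
  · rw [norm_mul, norm_star]
    calc _ ≤ 1 * δ := by gcongr
      _ = δ := one_mul δ
  rw [norm_neg]
  set D : ℝ → ℂ := fun t => ∑ j, tangentialVector i z j *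
        MvPolynomial.eval (fun i => ((t : ℂ) • z) i) (MvPolynomial.pderiv j p) with hD
  have hDc : Continuous D := by
    refine continuous_finsetSum _ fun j _ => continuous_const.mul ?_
    exact (MvPolynomial.continuous_eval _).comp (by simp; fun_prop)
  have hs1 : s ^ 2 ≤ 1 := by nlinarith
  rw [← intervalIntegral.integral_add_adjacent_intervals (b := R ^ 2)
    (hDc.intervalIntegrable _ _) (hDc.intervalIntegrable _ _)]
  refine (norm_add_le _ _).trans (add_le_add ?_ ?_)
  · have := intervalIntegral.norm_integral_le_of_norm_le_const (a := 0) (b := R ^ 2)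
      (f := D) (C := δ / (R * s)) fun t ht => ?_
    · refine this.trans (mul_le_of_le_one_right (by positivity) ?_)
      rw [sub_zero, abs_of_nonneg (by positivity)]
      nlinarith
    · rw [uIoc_of_le (by positivity)] at ht
      refine norm_deriv_line_le p (by positivity) hδ _ _ fun ζ hζ => ?_
      have := norm_add_smul_tangentialVector_le i hz t ζ
      rw [← sq_le_sq₀ (norm_nonneg _) hR.le]
      refine this.trans ?_
      rw [hζ]
      have h1 : t ^ 2 ≤ (R ^ 2) ^ 2 := by
        have := ht.1.le
        gcongr
        exact ht.2
      calc t ^ 2 + (R * s) ^ 2 ≤ R ^ 2 * (R ^ 2 + s ^ 2) := by linarith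
        _ = R ^ 2 := by rw [hRs, mul_one]
  · have h_int : ∫ t in (R ^ 2)..1, M * (1 - t) ^ (-(1 / 2) : ℝ) = 2 * M * s := by
      rw [intervalIntegral.integral_const_mul,
        intervalIntegral.integral_comp_sub_left (fun t => t ^ (-(1 / 2) : ℝ)),
        integral_rpow (Or.inl (by norm_num))]
      have e : 1 - R ^ 2 = s ^ 2 := by linarith
      rw [e, sub_self, ← Real.rpow_natCast, ← Real.rpow_mul hs.le]
      norm_num
      ring
    rw [← h_int]
    refine intervalIntegral.norm_integral_le_of_norm_le (by nlinarith) ?_ ?_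
    · have hne : ∀ᵐ t : ℝ, t ≠ 1 := by simp [ae_iff]
      filter_upwards [hne] with t ht1 ht
      have ht1 : t < 1 := lt_of_le_of_ne ht.2 ht1
      have ht0 : 0 < t := lt_of_le_of_lt (sq_nonneg R) ht.1
      have h1 : (0 : ℝ) < 1 - t := by linarith
      rw [Real.rpow_neg h1.le, ← Real.sqrt_eq_rpow, ← div_eq_mul_inv]
      refine norm_deriv_line_le p (Real.sqrt_pos.2 h1) hM _ _ fun ζ hζ => ?_
      have := norm_add_smul_tangentialVector_le i hz t ζ
      rw [hζ, Real.sq_sqrt h1.le] at this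
      rw [← sq_le_sq₀ (norm_nonneg _) zero_le_one]
      nlinarith
    · apply IntervalIntegrable.const_mul
      have := (intervalIntegral.intervalIntegrable_rpow' (a := 1 - R ^ 2) (b := 0)
        (r := -(1 / 2)) (by norm_num)).comp_sub_left 1
      simpa using this

/-- A bounded sequence of polynomials tending to zero locally uniformly on the open ball. -/
def VanishSeq (d : ℕ) (p : ℕ → MvPolynomial (Fin d) ℂ) : Prop :=
  (∃ C : ℝ, ∀ n z, ‖polyEval d (p n) z‖ ≤ C) ∧ ∀ R < (1 : ℝ), ∀ δ > (0 : ℝ), ∀ᶠ n in atTop,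
    ∀ z : CB d, ‖z.1‖ ≤ R → ‖polyEval d (p n) z‖ ≤ δ

theorem VanishSeq.add {d : ℕ} {p q : ℕ → MvPolynomial (Fin d) ℂ} (hp : VanishSeq d p)
    (hq : VanishSeq d q) : VanishSeq d (fun n => p n + q n) := by
  obtain ⟨⟨C, hC⟩, hp⟩ := hp
  obtain ⟨⟨C', hC'⟩, hq⟩ := hq
  refine ⟨⟨C + C', fun n z => ?_⟩, fun R hR δ hδ => ?_⟩
  · rw [map_add]
    exact (norm_add_le _ _).trans (add_le_add (hC n z) (hC' n z))
  · filter_upwards [hp R hR (δ / 2) (by positivity), hq R hR (δ / 2) (by positivity)]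
      with n h1 h2 z hz
    rw [map_add]
    exact (norm_add_le _ _).trans (by linarith [h1 z hz, h2 z hz])

theorem VanishSeq.mul_left {d : ℕ} (q : MvPolynomial (Fin d) ℂ)
    {p : ℕ → MvPolynomial (Fin d) ℂ} (hp : VanishSeq d p) : VanishSeq d (fun n => q * p n) := by
  obtain ⟨⟨C, hC⟩, hp⟩ := hp
  have key (n : ℕ) (z : CB d) : ‖polyEval d (q * p n) z‖ ≤
      (‖polyEval d q‖ + 1) * ‖polyEval d (p n) z‖ := by
    rw [map_mul, ContinuousMap.mul_apply, norm_mul]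
    gcongr
    linarith [(polyEval d q).norm_coe_le_norm z]
  refine ⟨⟨(‖polyEval d q‖ + 1) * C, fun n z => (key n z).trans ?_⟩, fun R hR δ hδ => ?_⟩
  · have := hC n z
    gcongr
  · have h0 : 0 < ‖polyEval d q‖ + 1 := by positivity
    filter_upwards [hp R hR (δ / (‖polyEval d q‖ + 1)) (by positivity)] with n h1 z hz
    refine (key n z).trans ?_
    rw [← le_div_iff₀' h0]
    exact h1 z hz

theorem VanishSeq.exists_conj_mul {d : ℕ} (hd : 1 ≤ d) (i : Fin d)
    {p : ℕ → MvPolynomial (Fin d) ℂ} (hp : VanishSeq d p) :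
    ∃ q, VanishSeq d q ∧ ∀ η > (0 : ℝ), ∀ᶠ n in atTop, ∀ z ∈ sphereD d,
      ‖star (z.1 i) * polyEval d (p n) z - polyEval d (q n) z‖ ≤ η := by
  obtain ⟨⟨M, hM⟩, hp⟩ := hp
  have hM0 : 0 ≤ M := (norm_nonneg _).trans (hM 0 (ballZero d))
  choose q hq using fun n => (MvPolynomial.pderiv i (p n)).exists_eval_eq_integral
  have hM' (n : ℕ) (z : EuclideanSpace ℂ (Fin d)) (hz : ‖z‖ ≤ 1) :
      ‖MvPolynomial.eval (fun i => z i) (p n)‖ ≤ M := by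
    simpa [polyEval_apply] using hM n ⟨z, by simpa using hz⟩
  have hp' (R : ℝ) (hR : R < 1) (δ : ℝ) (hδ : 0 < δ) : ∀ᶠ n in atTop,
      ∀ z : EuclideanSpace ℂ (Fin d), ‖z‖ ≤ R →
        ‖MvPolynomial.eval (fun i => z i) (p n)‖ ≤ δ := by
    filter_upwards [hp R hR δ hδ] with n hn z hz
    simpa [polyEval_apply] using hn ⟨z, by simpa using hz.trans hR.le⟩ hz
  refine ⟨q, ⟨⟨M + (M + (M / (3 / 5 * (4 / 5)) + 2 * M * (4 / 5))), fun n => ?_⟩, ?_⟩, ?_⟩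
  · refine norm_le_of_le_sphereD hd _ fun z hz => ?_
    have h1 := norm_conj_mul_sub_le i (p n) (q n) (hq n) (R := 3 / 5) (s := 4 / 5) (by norm_num)
      (by norm_num) (by norm_num) (hM' n) (fun z hz => hM' n z (hz.trans (by norm_num))) hz
    have h2 : ‖star (z.1 i) * MvPolynomial.eval (fun i => z.1 i) (p n)‖ ≤ M := by
      rw [norm_mul, norm_star]
      have hzi : ‖z.1 i‖ ≤ 1 := le_of_le_of_eq (PiLp.norm_apply_le z.1 i) hz
      calc _ ≤ 1 * M := by
            gcongr
            exact hM' n z.1 hz.le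
        _ = M := one_mul M
    rw [polyEval_apply]
    have := norm_sub_le (star (z.1 i) * MvPolynomial.eval (fun i => z.1 i) (p n))
      (star (z.1 i) * MvPolynomial.eval (fun i => z.1 i) (p n) -
        MvPolynomial.eval (fun i => z.1 i) (q n))
    rw [sub_sub_cancel] at this
    linarith
  · intro R hR δ hδ
    have hρ : 0 < (1 - R) / 2 := by linarith
    filter_upwards [hp' ((1 + R) / 2) (by linarith) (δ * ((1 - R) / 2)) (by positivity)]
      with n hn z hz
    rw [polyEval_apply, hq]
    have := intervalIntegral.norm_integral_le_of_norm_le_const (a := 0) (b := 1) (C := δ)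
      (f := fun t : ℝ => MvPolynomial.eval (fun i => (t : ℂ) * z.1 i)
        (MvPolynomial.pderiv i (p n))) fun t ht => ?_
    · simpa using this
    · rw [uIoc_of_le zero_le_one] at ht
      have := norm_deriv_line_le (p n) hρ hn ((t : ℂ) • z.1) (EuclideanSpace.single i 1)
        fun ζ hζ => ?_
      · rw [mul_div_cancel_right₀ _ hρ.ne', Finset.sum_eq_single i] at this
        · simpa using this
        · simp +contextual
        · simp
      · refine (norm_add_le _ _).trans ?_
        rw [norm_smul, norm_smul, hζ, Complex.norm_real, Real.norm_of_nonneg ht.1.le]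
        have : t * ‖z.1‖ ≤ ‖z.1‖ := mul_le_of_le_one_left (norm_nonneg _) ht.2
        simp
        linarith
  · intro η hη
    obtain ⟨s, hs0, hs1, hs⟩ : ∃ s : ℝ, 0 < s ∧ s < 1 ∧ 2 * M * s ≤ η / 2 := by
      refine ⟨min (1 / 2) (η / (4 * (M + 1))), by positivity, by
        linarith [min_le_left (1 / 2) (η / (4 * (M + 1)))], ?_⟩
      calc 2 * M * min (1 / 2) (η / (4 * (M + 1))) ≤ 2 * (M + 1) * (η / (4 * (M + 1))) := by
            gcongr
            · linarith
            · exact min_le_right _ _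
        _ = η / 2 := by field_simp; ring
    have hs2 : s ^ 2 < 1 := by nlinarith
    set R := √(1 - s ^ 2) with hRdef
    have hR : 0 < R := Real.sqrt_pos.2 (by linarith)
    have hRs : R ^ 2 + s ^ 2 = 1 := by
      rw [hRdef, Real.sq_sqrt (by linarith)]
      ring
    have hR1 : R < 1 := by nlinarith [pow_pos hs0 2]
    have hδ : 0 < η / 2 / (1 + 1 / (R * s)) := by positivity
    filter_upwards [hp' R hR1 _ hδ] with n hn z hz
    rw [polyEval_apply, polyEval_apply]
    refine (norm_conj_mul_sub_le i (p n) (q n) (hq n) hR hs0 hRs (hM' n) hn hz).trans ?_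
    have : η / 2 / (1 + 1 / (R * s)) + η / 2 / (1 + 1 / (R * s)) / (R * s) = η / 2 := by
      have : (1 + 1 / (R * s)) ≠ 0 := by positivity
      field_simp
    linarith

/-- The continuous functions on the closed ball which, restricted to the sphere, multiply
`VanishSeq` sequences into `VanishSeq` sequences up to a uniformly small error. -/
def asympMultiplier (d : ℕ) : Subalgebra ℂ C(CB d, ℂ) where
  carrier := {F | ∀ p, VanishSeq d p → ∃ q, VanishSeq d q ∧ ∀ η > (0 : ℝ), ∀ᶠ n in atTop,
    ∀ z ∈ sphereD d, ‖F z * polyEval d (p n) z - polyEval d (q n) z‖ ≤ η}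
  add_mem' {F G} hF hG p hp := by
    obtain ⟨q, hq, hFq⟩ := hF p hp
    obtain ⟨r, hr, hGr⟩ := hG p hp
    refine ⟨_, hq.add hr, fun η hη => ?_⟩
    filter_upwards [hFq (η / 2) (by positivity), hGr (η / 2) (by positivity)] with n h1 h2 z hz
    have e : (F + G) z * polyEval d (p n) z - polyEval d (q n + r n) z =
        (F z * polyEval d (p n) z - polyEval d (q n) z) +
          (G z * polyEval d (p n) z - polyEval d (r n) z) := by
      rw [map_add, ContinuousMap.add_apply, ContinuousMap.add_apply]
      ring
    rw [e]
    exact (norm_add_le _ _).trans (by linarith [h1 z hz, h2 z hz])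
  mul_mem' {F G} hF hG p hp := by
    obtain ⟨q, hq, hGq⟩ := hG p hp
    obtain ⟨r, hr, hFr⟩ := hF q hq
    refine ⟨r, hr, fun η hη => ?_⟩
    filter_upwards [hGq (η / 2 / (‖F‖ + 1)) (by positivity), hFr (η / 2) (by positivity)]
      with n h1 h2 z hz
    have e : (F * G) z * polyEval d (p n) z - polyEval d (r n) z =
        F z * (G z * polyEval d (p n) z - polyEval d (q n) z) +
          (F z * polyEval d (q n) z - polyEval d (r n) z) := by
      rw [ContinuousMap.mul_apply]
      ring
    rw [e]
    refine (norm_add_le _ _).trans ?_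
    have h3 : ‖F z * (G z * polyEval d (p n) z - polyEval d (q n) z)‖ ≤ η / 2 := by
      rw [norm_mul]
      calc _ ≤ (‖F‖ + 1) * (η / 2 / (‖F‖ + 1)) := by
            gcongr
            · linarith [F.norm_coe_le_norm z]
            · exact h1 z hz
        _ = η / 2 := by field_simp
    linarith [h2 z hz]
  algebraMap_mem' c p hp := by
    refine ⟨_, hp.mul_left (MvPolynomial.C c), fun η hη => Eventually.of_forall fun n z hz => ?_⟩
    simp [hη.le]

theorem asympMultiplier_closure_eq_top {d : ℕ} (hd : 1 ≤ d) :
    (asympMultiplier d).topologicalClosure = ⊤ := by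
  let x (i : Fin d) : C(CB d, ℂ) := ⟨fun z => z.1 i,
    (EuclideanSpace.proj (𝕜 := ℂ) i).continuous.comp continuous_subtype_val⟩
  have hx (i : Fin d) : x i ∈ asympMultiplier d := fun p hp =>
    ⟨_, hp.mul_left (MvPolynomial.X i), fun η hη => Eventually.of_forall fun n z _ => by
      have : x i z = z.1 i := rfl
      simp [polyEval_apply, this, hη.le]⟩
  have hsx (i : Fin d) : star (x i) ∈ asympMultiplier d := fun p hp => hp.exists_conj_mul hd i
  have hle : (StarAlgebra.adjoin ℂ (range x)).toSubalgebra ≤ asympMultiplier d := by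
    rw [StarAlgebra.adjoin_toSubalgebra, Algebra.adjoin_le_iff]
    rintro f (⟨i, rfl⟩ | ⟨i, hi⟩)
    · exact hx i
    · rw [← star_star f, ← hi]
      exact hsx i
  have htop := ContinuousMap.starSubalgebra_topologicalClosure_eq_top_of_separatesPoints
    (StarAlgebra.adjoin ℂ (range x)) (by
      intro z w hzw
      have : ∃ i, z.1 i ≠ w.1 i := by
        by_contra! h
        exact hzw (Subtype.ext (PiLp.ext h))
      obtain ⟨i, hi⟩ := this
      exact ⟨x i, ⟨x i, StarAlgebra.subset_adjoin ℂ _ (mem_range_self i), rfl⟩, hi⟩)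
  rw [eq_top_iff]
  intro f _
  have hf : f ∈ (StarAlgebra.adjoin ℂ (range x)).topologicalClosure := htop ▸ trivial
  exact closure_mono hle hf

theorem exists_vanishSeq_near_one {d : ℕ} (hd : 1 ≤ d) {K : Set (CB d)} (hKc : IsClosed K)
    (hTN : IsTotallyNull d K) {N : ℕ} (hN : 0 < N) :
    ∃ p, VanishSeq d p ∧ ∀ η > (0 : ℝ), ∀ᶠ n in atTop,
      (∀ z, ‖polyEval d (p n) z‖ + ‖1 - polyEval d (p n) z‖ ≤ 1 + 6 / N + η) ∧
      ∀ z ∈ K, ‖1 - polyEval d (p n) z‖ ≤ η := by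
  have key (n : ℕ) : ∃ p : MvPolynomial (Fin d) ℂ,
      (∀ z, ‖polyEval d p z‖ + ‖1 - polyEval d p z‖ ≤ 1 + 6 / N + 2 * (1 / ((n : ℝ) + 1))) ∧
      (∀ z ∈ K, ‖1 - polyEval d p z‖ ≤ 2 * (1 / ((n : ℝ) + 1))) ∧
      ∀ r, 0 < r → r < 1 → ∀ z : CB d, ‖z.1‖ ≤ r →
        ‖polyEval d p z‖ ≤ (4 ^ N * ((1 + r) / (1 - r)) + 1) * (1 / ((n : ℝ) + 1)) := by
    have hn : (0 : ℝ) < (n : ℝ) + 1 := by positivity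
    obtain ⟨h, h1, h2, h3⟩ := exists_poly_of_totallyNull hd hKc hTN
      (ε := 1 / ((n : ℝ) + 1) ^ 2) (by positivity)
    set f := MvPolynomial.C (((n : ℝ) + 1 : ℝ) : ℂ) * h with hf
    have hfz (z : CB d) : polyEval d f z = (((n : ℝ) + 1 : ℝ) : ℂ) * polyEval d h z := by
      rw [hf, map_mul, ContinuousMap.mul_apply, polyEval_C_apply]
    have hf1 (z : CB d) : 0 ≤ (polyEval d f z).re := by
      rw [hfz, Complex.re_ofReal_mul]
      exact mul_nonneg hn.le (h1 z)
    have hf2 (z : CB d) (hz : z ∈ K) : (n : ℝ) + 1 ≤ (polyEval d f z).re := by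
      rw [hfz, Complex.re_ofReal_mul]
      exact le_mul_of_one_le_right hn.le (h2 z hz)
    have hf3 : ‖polyEval d f ⟨0, by simp⟩‖ ≤ 1 / ((n : ℝ) + 1) := by
      rw [hfz, norm_mul, Complex.norm_real, Real.norm_of_nonneg hn.le]
      calc _ ≤ ((n : ℝ) + 1) * (1 / ((n : ℝ) + 1) ^ 2) := by
            gcongr
            exact h3.le
        _ = 1 / ((n : ℝ) + 1) := by field_simp
    obtain ⟨g, hg, hgz⟩ := exists_thin (polyEval_mem f) hf1 hN
    obtain ⟨p, hp⟩ := exists_polyEval_near hg (δ := 1 / ((n : ℝ) + 1)) (by positivity)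
    have hpz (z : CB d) : ‖g z - polyEval d p z‖ ≤ 1 / ((n : ℝ) + 1) :=
      ((g - polyEval d p).norm_coe_le_norm z).trans hp.le
    have hp1 (z : CB d) : ‖polyEval d p z‖ ≤ ‖g z‖ + 1 / ((n : ℝ) + 1) := by
      linarith [norm_le_norm_add_norm_sub (g z) (polyEval d p z), hpz z]
    have hp2 (z : CB d) : ‖1 - polyEval d p z‖ ≤ ‖1 - g z‖ + 1 / ((n : ℝ) + 1) := by
      have := norm_add_le (1 - g z) (g z - polyEval d p z)
      rw [sub_add_sub_cancel] at this
      linarith [hpz z]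
    refine ⟨p, fun z => ?_, fun z hz => ?_, fun r hr0 hr z hz => ?_⟩
    · linarith [hp1 z, hp2 z, (hgz z).1]
    · linarith [hp2 z, (hgz z).2.2 _ hn (hf2 z hz)]
    · have hr' : 0 < 1 - r := by linarith
      have h4 : ‖polyEval d f z‖ ≤ 1 / ((n : ℝ) + 1) * ((1 + r) / (1 - r)) := by
        refine (polyEval_harnack f hf1 hr0 hr hz).trans ?_
        rw [mul_div_assoc]
        gcongr
      calc _ ≤ ‖g z‖ + 1 / ((n : ℝ) + 1) := hp1 z
        _ ≤ 4 ^ N * ‖polyEval d f z‖ + 1 / ((n : ℝ) + 1) := by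
            gcongr
            exact (hgz z).2.1
        _ ≤ 4 ^ N * (1 / ((n : ℝ) + 1) * ((1 + r) / (1 - r))) + 1 / ((n : ℝ) + 1) := by
            gcongr
        _ = _ := by ring
  choose p hp1 hp2 hp3 using key
  have hsmall (c δ : ℝ) (hδ : 0 < δ) : ∀ᶠ n : ℕ in atTop, c * (1 / ((n : ℝ) + 1)) ≤ δ := by
    have := tendsto_one_div_add_atTop_nhds_zero_nat (𝕜 := ℝ).const_mul c
    rw [mul_zero] at this
    exact (this.eventually_lt_const hδ).mono fun _ h => h.le
  refine ⟨p, ⟨⟨1 + 6 / N + 2, fun n z => ?_⟩, fun R hR δ hδ => ?_⟩, fun η hη => ?_⟩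
  · have h1 : 1 / ((n : ℝ) + 1) ≤ 1 := by
      rw [div_le_one (by positivity)]
      linarith [Nat.cast_nonneg (α := ℝ) n]
    linarith [hp1 n z, norm_nonneg (1 - polyEval d (p n) z)]
  · filter_upwards [hsmall _ δ hδ] with n hn z hz
    exact (hp3 n (max R (1 / 2)) (by positivity) (max_lt hR (by norm_num)) z
      (hz.trans (le_max_left _ _))).trans hn
  · filter_upwards [hsmall 2 η hη] with n hn
    exact ⟨fun z => by linarith [hp1 n z], fun z hz => (hp2 n z hz).trans hn⟩

theorem exists_mem_ballAlgSub_approx {d : ℕ} (hd : 1 ≤ d) {K : Set (CB d)} (hKc : IsClosed K)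
    (hTN : IsTotallyNull d K) {lam : CB d} (hlam : lam ∈ openD d) {F : C(CB d, ℂ)}
    (hF : ‖F‖ ≤ 1) {ε : ℝ} (hε : 0 < ε) (hε1 : ε ≤ 1) :
    ∃ φ ∈ ballAlgSub d, ‖φ‖ ≤ 1 + ε ∧ ∀ z ∈ K ∪ {lam}, ‖φ z - F z‖ ≤ ε := by
  obtain ⟨P, hP, hPF⟩ : ∃ P ∈ asympMultiplier d, ‖F - P‖ < ε / 4 := by
    have : F ∈ closure (asympMultiplier d : Set C(CB d, ℂ)) := by
      rw [← Subalgebra.topologicalClosure_coe, asympMultiplier_closure_eq_top hd]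
      trivial
    simpa [dist_eq_norm] using Metric.mem_closure_iff.1 this (ε / 4) (by positivity)
  obtain ⟨N, hN⟩ := exists_nat_gt (6 / (ε / 8))
  have hN0 : (0 : ℝ) < N := lt_trans (by positivity) hN
  have hN6 : 6 / (N : ℝ) ≤ ε / 8 := by
    rw [div_lt_iff₀ (by positivity)] at hN
    rw [div_le_iff₀ hN0]
    linarith
  obtain ⟨p, hp, hpK⟩ := exists_vanishSeq_near_one hd hKc hTN (N := N) (by exact_mod_cast hN0)
  obtain ⟨q, hq, hPq⟩ := hP p hp
  have hη : 0 < ε / 8 := by positivity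
  obtain ⟨n, h1, h2, h3, h4⟩ := ((hpK _ hη).and ((hPq _ hη).and
    ((hp.2 _ hlam _ hη).and (hq.2 _ hlam _ hη)))).exists
  have hFz (z : CB d) : ‖F z‖ ≤ 1 := (F.norm_coe_le_norm z).trans hF
  have hPFz (z : CB d) : ‖F z - P z‖ ≤ ε / 4 := ((F - P).norm_coe_le_norm z).trans hPF.le
  have hφ (z : CB d) : polyEval d (q n + MvPolynomial.C (F lam) * (1 - p n)) z =
      polyEval d (q n) z + F lam * (1 - polyEval d (p n) z) := by simp
  refine ⟨_, polyEval_mem (q n + MvPolynomial.C (F lam) * (1 - p n)), ?_, ?_⟩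
  · rw [ContinuousMap.norm_le _ (by positivity)]
    refine norm_le_of_le_sphereD hd _ fun z hz => ?_
    rw [hφ]
    have hPz : ‖P z‖ ≤ 1 + ε / 4 := by
      have := norm_sub_norm_le (P z) (F z)
      rw [norm_sub_rev] at this
      linarith [hPFz z, hFz z]
    have hqz : ‖polyEval d (q n) z‖ ≤ (1 + ε / 4) * ‖polyEval d (p n) z‖ + ε / 8 := by
      have := norm_le_norm_add_norm_sub (P z * polyEval d (p n) z) (polyEval d (q n) z)
      have h5 : ‖P z * polyEval d (p n) z‖ ≤ (1 + ε / 4) * ‖polyEval d (p n) z‖ := by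
        rw [norm_mul]
        gcongr
      linarith [h2 z hz]
    have h6 : ‖F lam * (1 - polyEval d (p n) z)‖ ≤ ‖1 - polyEval d (p n) z‖ := by
      rw [norm_mul]
      exact mul_le_of_le_one_left (norm_nonneg _) (hFz lam)
    refine (norm_add_le _ _).trans ?_
    have h7 := h1.1 z
    nlinarith [norm_nonneg (1 - polyEval d (p n) z)]
  · rintro z (hz | rfl)
    · rw [hφ]
      have h5 := h1.2 z hz
      have e : polyEval d (q n) z + F lam * (1 - polyEval d (p n) z) - F z =
          (F lam - P z) * (1 - polyEval d (p n) z) -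
            (P z * polyEval d (p n) z - polyEval d (q n) z) - (F z - P z) := by ring
      have h6 : ‖(F lam - P z) * (1 - polyEval d (p n) z)‖ ≤ 3 * (ε / 8) := by
        rw [norm_mul]
        gcongr
        have := norm_sub_norm_le (P z) (F z)
        rw [norm_sub_rev] at this
        linarith [hPFz z, hFz z, hFz lam, norm_sub_le (F lam) (P z)]
      rw [e]
      refine (norm_sub_le _ _).trans ?_
      refine (add_le_add_left (norm_sub_le _ _) _).trans ?_
      linarith [hPFz z, h2 z (hTN.1 hz)]
    · rw [hφ]
      have e : polyEval d (q n) z + F z * (1 - polyEval d (p n) z) - F z =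
          polyEval d (q n) z - F z * polyEval d (p n) z := by ring
      have h6 : ‖F z * polyEval d (p n) z‖ ≤ ‖polyEval d (p n) z‖ := by
        rw [norm_mul]
        exact mul_le_of_le_one_left (norm_nonneg _) (hFz z)
      rw [e]
      refine (norm_sub_le _ _).trans ?_
      linarith [h3 z le_rfl, h4 z le_rfl]

/-- A norm preserving Tietze extension in a compact Hausdorff space. -/
theorem exists_norm_le_extension {Y : Type*} [TopologicalSpace Y] [CompactSpace Y] [T2Space Y]
    {X : Set Y} (hX : IsClosed X) {f : X → ℂ} (hf : Continuous f) {m : ℝ} (hm : 0 ≤ m)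
    (hfm : ∀ z, ‖f z‖ ≤ m) : ∃ G : C(Y, ℂ), ‖G‖ ≤ m ∧ ∀ z : X, G z = f z := by
  obtain ⟨g, hg1, hg2⟩ := BoundedContinuousFunction.exists_norm_eq_domRestrict_eq (𝕜 := ℂ) hX
    (BoundedContinuousFunction.ofNormedAddCommGroup f hf m hfm)
  refine ⟨g.toContinuousMap, ?_, fun z => ?_⟩
  · rw [ContinuousMap.norm_le _ hm]
    intro z
    refine (g.norm_coe_le_norm z).trans ?_
    rw [hg1]
    exact BoundedContinuousFunction.norm_ofNormedAddCommGroup_le hf hm hfm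
  · exact congrArg (fun h : BoundedContinuousFunction X ℂ => h z) hg2

theorem exists_mem_ballAlgSub_approx_of_norm_le {d : ℕ} (hd : 1 ≤ d) {K : Set (CB d)}
    (hKc : IsClosed K) (hTN : IsTotallyNull d K) {lam : CB d} (hlam : lam ∈ openD d)
    (F : C(CB d, ℂ)) {m ε : ℝ} (hm : 0 ≤ m) (hε : 0 < ε)
    (hF : ∀ z ∈ K ∪ {lam}, ‖F z‖ ≤ m) :
    ∃ φ ∈ ballAlgSub d, ‖φ‖ ≤ m + ε ∧ ∀ z ∈ K ∪ {lam}, ‖F z - φ z‖ ≤ ε := by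
  obtain ⟨G, hG, hGF⟩ := exists_norm_le_extension (hKc.union isClosed_singleton)
    (F.continuous.comp continuous_subtype_val) hm (fun z => hF z.1 z.2)
  set c := m + ε / 2 with hc
  have hc0 : 0 < c := by positivity
  have hcn : ‖(c : ℂ)‖ = c := by rw [Complex.norm_real, Real.norm_of_nonneg hc0.le]
  have hcc : (c : ℂ) ≠ 0 := by exact_mod_cast hc0.ne'
  obtain ⟨φ, hφ, hφ1, hφ2⟩ := exists_mem_ballAlgSub_approx hd hKc hTN hlam
    (F := (c : ℂ)⁻¹ • G) (by
      rw [norm_smul, norm_inv, hcn, inv_mul_le_iff₀ hc0]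
      linarith) (ε := ε / 2 / c) (by positivity) (by
      rw [div_le_one hc0]
      linarith)
  refine ⟨(c : ℂ) • φ, Subalgebra.smul_mem _ hφ _, ?_, fun z hz => ?_⟩
  · rw [norm_smul, hcn]
    calc _ ≤ c * (1 + ε / 2 / c) := by gcongr
      _ = m + ε := by
        field_simp
        rw [hc]
        ring
  · have h1 := hφ2 z hz
    have h2 : G z = F z := hGF ⟨z, hz⟩
    have e : F z - ((c : ℂ) • φ) z = -((c : ℂ) * (φ z - ((c : ℂ)⁻¹ • G) z)) := by
      rw [ContinuousMap.smul_apply, ContinuousMap.smul_apply, smul_eq_mul, smul_eq_mul, mul_sub,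
        mul_inv_cancel_left₀ hcc, h2]
      ring
    rw [e, norm_neg, norm_mul, hcn]
    calc _ ≤ c * (ε / 2 / c) := by gcongr
      _ ≤ ε := by
        field_simp
        linarith

/-- Successive approximation: approximate interpolation with norm control in a closed subspace
upgrades to exact interpolation. -/
theorem Submodule.exists_eqOn_of_approx {Y : Type*} [TopologicalSpace Y] [CompactSpace Y]
    {A : Submodule ℂ C(Y, ℂ)} (hA : IsClosed (A : Set C(Y, ℂ))) {X : Set Y}
    (happ : ∀ (F : C(Y, ℂ)) (m ε : ℝ), 0 ≤ m → 0 < ε → (∀ z ∈ X, ‖F z‖ ≤ m) →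
      ∃ φ ∈ A, ‖φ‖ ≤ m + ε ∧ ∀ z ∈ X, ‖F z - φ z‖ ≤ ε)
    (F : C(Y, ℂ)) {m ε : ℝ} (hm : 0 ≤ m) (hε : 0 < ε) (hF : ∀ z ∈ X, ‖F z‖ ≤ m) :
    ∃ φ ∈ A, ‖φ‖ ≤ m + ε ∧ ∀ z ∈ X, φ z = F z := by
  choose! Φ hΦA hΦ1 hΦ2 using happ
  let e : ℕ → ℝ := fun k => ε / 2 / 2 / 2 ^ k
  let b : ℕ → ℝ := fun k => Nat.casesOn k m e
  have he0 (k : ℕ) : 0 < e k := by positivity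
  have hb0 (k : ℕ) : 0 ≤ b k := by
    cases k
    · exact hm
    · exact (he0 _).le
  have hesum : HasSum e (ε / 2) := hasSum_geometric_two' _
  have hbsum : HasSum b (m + ε / 2) := by
    rw [add_comm]
    exact (hasSum_nat_add_iff' 1).1 (by simpa [b] using hesum)
  let G : ℕ → C(Y, ℂ) := fun k => Nat.rec F (fun k g => g - Φ g (b k) (e k)) k
  have hG (k : ℕ) : ∀ z ∈ X, ‖G k z‖ ≤ b k := by
    induction k with
    | zero => exact hF
    | succ k ih => exact hΦ2 (G k) (b k) (e k) (hb0 k) (he0 k) ih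
  let φ : ℕ → C(Y, ℂ) := fun k => Φ (G k) (b k) (e k)
  have hφ1 (k : ℕ) : ‖φ k‖ ≤ b k + e k := hΦ1 _ _ _ (hb0 k) (he0 k) (hG k)
  have hφA (k : ℕ) : φ k ∈ A := hΦA _ _ _ (hb0 k) (he0 k) (hG k)
  have hpart (n : ℕ) : ∑ k ∈ Finset.range n, φ k = F - G n := by
    induction n with
    | zero => simp [G]
    | succ n ih =>
      rw [Finset.sum_range_succ, ih]
      simp only [G, φ]
      abel
  have hbe := hbsum.add hesum
  have hφs : Summable φ := Summable.of_norm_bounded hbe.summable hφ1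
  have hlim := hφs.hasSum.tendsto_sum_nat
  refine ⟨∑' k, φ k, hA.mem_of_tendsto hlim (Eventually.of_forall fun n =>
    A.sum_mem fun k _ => hφA k), ?_, fun z hz => ?_⟩
  · refine (tsum_of_norm_bounded hbe hφ1).trans_eq (by ring)
  · have h1 : Tendsto (fun n => (F - G n) z) atTop (𝓝 ((∑' k, φ k) z)) := by
      simp only [hpart] at hlim
      exact (continuous_eval_const z).tendsto (∑' k, φ k) |>.comp hlim
    have h2 : Tendsto (fun n => G n z) atTop (𝓝 0) :=
      squeeze_zero_norm (fun n => hG n z hz) hbsum.summable.tendsto_atTop_zero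
    refine tendsto_nhds_unique h1 ?_
    simpa using (tendsto_const_nhds (x := F z)).sub h2

/-- the restriction map is surjective from the ball algebra onto
`C(K ∪ {λ})`, and the distance from `φ` to `I(K ∪ {λ})` is the sup of `|φ|` on
`K ∪ {λ}`. -/
theorem stmt11 (d : ℕ) (hd : 1 ≤ d) (K : Set (CB d)) (hKc : IsClosed K)
    (hTN : IsTotallyNull d K) (lam : CB d) (hlam : lam ∈ openD d) :
    (∀ f : ↥(K ∪ {lam}) → ℂ, Continuous f →
        ∃ φ ∈ ballAlg d, ∀ z : ↥(K ∪ {lam}), φ z.1 = f z) ∧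
    ∀ φ ∈ ballAlg d,
      Metric.infDist φ (IX d (K ∪ {lam})) = ⨆ z : ↥(K ∪ {lam}), ‖φ z.1‖ := by
  have hX : IsClosed (K ∪ {lam}) := hKc.union isClosed_singleton
  have interp (F : C(CB d, ℂ)) {m ε : ℝ} (hm : 0 ≤ m) (hε : 0 < ε)
      (hF : ∀ z ∈ K ∪ {lam}, ‖F z‖ ≤ m) :
      ∃ φ ∈ ballAlgSub d, ‖φ‖ ≤ m + ε ∧ ∀ z ∈ K ∪ {lam}, φ z = F z :=
    Submodule.exists_eqOn_of_approx (A := Subalgebra.toSubmodule (ballAlgSub d))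
      (polyAlg d).isClosed_topologicalClosure
      (fun F m ε hm hε hF => exists_mem_ballAlgSub_approx_of_norm_le hd hKc hTN hlam F hm hε hF)
      F hm hε hF
  refine ⟨fun f hf => ?_, fun φ hφ => ?_⟩
  · have : CompactSpace ↥(K ∪ {lam}) := isCompact_iff_compactSpace.1 hX.isCompact
    obtain ⟨G, -, hG⟩ := exists_norm_le_extension hX hf (norm_nonneg (⟨f, hf⟩ : C(_, ℂ)))
      (ContinuousMap.norm_coe_le_norm (⟨f, hf⟩ : C(_, ℂ)))
    obtain ⟨φ, hφ, -, hφG⟩ := interp G (norm_nonneg G) one_pos fun z _ => G.norm_coe_le_norm z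
    exact ⟨φ, hφ, fun z => (hφG z z.2).trans (hG z)⟩
  · have hne : Nonempty ↥(K ∪ {lam}) := ⟨⟨lam, Or.inr rfl⟩⟩
    have hbdd : BddAbove (range fun z : ↥(K ∪ {lam}) => ‖φ z.1‖) :=
      ⟨‖φ‖, by rintro _ ⟨z, rfl⟩; exact φ.norm_coe_le_norm z.1⟩
    have hIX : (IX d (K ∪ {lam})).Nonempty :=
      ⟨0, (ballAlgSub d).zero_mem, fun _ _ => rfl⟩
    apply le_antisymm
    · refine le_of_forall_pos_le_add fun ε hε => ?_
      obtain ⟨ψ, hψ, hψ1, hψ2⟩ := interp φ (Real.iSup_nonneg fun _ => norm_nonneg _) hε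
        fun z hz => le_ciSup hbdd ⟨z, hz⟩
      have hmem : φ - ψ ∈ IX d (K ∪ {lam}) := ⟨(ballAlgSub d).sub_mem hφ hψ, fun z hz => by
        rw [ContinuousMap.sub_apply, hψ2 z hz, sub_self]⟩
      refine (infDist_le_dist_of_mem hmem).trans ?_
      rwa [dist_eq_norm, sub_sub_cancel]
    · refine (le_infDist hIX).2 fun ψ hψ => ciSup_le fun z => ?_
      rw [dist_eq_norm]
      have := (φ - ψ).norm_coe_le_norm z.1
      rwa [ContinuousMap.sub_apply, hψ.2 z.1 z.2, sub_zero] at this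

end
end

section
/- Let J ⊆ A(𝔹_d) be a closed ideal and let μ be an A(𝔹_d)-totally singular complex regular Borel measure on 𝕊_d such that ∫_{𝕊_d} φ dμ = 0 for every φ ∈ J. Then μ is concentrated on Z(J) ∩ 𝕊_d, i.e., |μ|(𝕊_d \ Z(J)) = 0. -/
open MeasureTheory Metric Set Filter Topology

noncomputable section

open scoped ENNReal NNReal in
theorem CMeasure.isFiniteMeasure_withDensity_nnnorm {d : ℕ} (μ : CMeasure d) (φ : C(CB d, ℂ)) :
    IsFiniteMeasure (μ.var.withDensity fun z => (‖φ z‖₊ : ℝ≥0∞)) := by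
  have := μ.finite
  refine isFiniteMeasure_withDensity (ne_of_lt ?_)
  calc ∫⁻ z, (‖φ z‖₊ : ℝ≥0∞) ∂μ.var ≤ ∫⁻ _, (‖φ‖₊ : ℝ≥0∞) ∂μ.var :=
        lintegral_mono fun z => ENNReal.coe_le_coe.2 (φ.norm_coe_le_norm z)
    _ < ∞ := by
        rw [lintegral_const]
        exact ENNReal.mul_lt_top ENNReal.coe_lt_top (measure_lt_top _ _)

open scoped ENNReal NNReal in
/-- The complex measure `φ μ`, in polar form. -/
def CMeasure.mulCont {d : ℕ} (μ : CMeasure d) (φ : C(CB d, ℂ)) : CMeasure d where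
  var := μ.var.withDensity fun z => (‖φ z‖₊ : ℝ≥0∞)
  density := fun z => (if φ z = 0 then 1 else φ z / (‖φ z‖ : ℂ)) * μ.density z
  finite := μ.isFiniteMeasure_withDensity_nnnorm φ
  regular := by
    have := μ.isFiniteMeasure_withDensity_nnnorm φ
    infer_instance
  measurable_density := by
    have hφ : Measurable φ := φ.continuous.measurable
    refine Measurable.mul (Measurable.ite (hφ (measurableSet_singleton 0)) measurable_const ?_)
      μ.measurable_density
    exact hφ.div (Complex.measurable_ofReal.comp hφ.norm)
  norm_density := fun z => by
    rw [norm_mul, μ.norm_density, mul_one]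
    split_ifs with h
    · exact norm_one
    · simp [h]
  onSphere := withDensity_absolutelyContinuous _ _ μ.onSphere

theorem cInt_mulCont {d : ℕ} (μ : CMeasure d) (φ f : C(CB d, ℂ)) :
    cInt d (μ.mulCont φ) f = cInt d μ (f * φ) := by
  have hφ : Measurable fun z => ‖φ z‖₊ := φ.continuous.measurable.nnnorm
  unfold cInt
  simp only [CMeasure.mulCont]
  rw [integral_withDensity_eq_integral_smul hφ]
  refine integral_congr_ae (Eventually.of_forall fun z => ?_)
  by_cases h : φ z = 0
  · simp [h]
  · have h' : (‖φ z‖ : ℂ) ≠ 0 := by simpa using h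
    simp only [h, if_false, NNReal.smul_def, coe_nnnorm, Complex.real_smul,
      ContinuousMap.mul_apply]
    field_simp

/-- If `φ μ` annihilates the ball algebra and `μ` is totally singular, then `φ` vanishes
`μ`-almost everywhere. -/
theorem IsTotallySingularC.ae_eq_zero {d : ℕ} {μ : CMeasure d} (hsing : IsTotallySingularC d μ)
    {φ : C(CB d, ℂ)} (hann : ∀ f ∈ ballAlg d, cInt d μ (f * φ) = 0) :
    ∀ᵐ z ∂μ.var, φ z = 0 := by
  have hν : IsHenkinC d (μ.mulCont φ) := fun f hf _ _ => by
    simp only [cInt_mulCont, fun n => hann (f n) (hf n)]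
    exact tendsto_const_nhds
  have h0 : (μ.mulCont φ).var = 0 :=
    Measure.eq_zero_of_absolutelyContinuous_of_mutuallySingular
      (withDensity_absolutelyContinuous _ _) (hsing _ hν).symm
  have h1 := (withDensity_eq_zero_iff
    φ.continuous.measurable.nnnorm.coe_nnreal_ennreal.aemeasurable).1 h0
  filter_upwards [h1] with z hz
  simpa using hz

/-- a totally singular measure annihilating a closed ideal `J` is
concentrated on `Z(J) ∩ 𝕊_d`. -/
theorem stmt13 (d : ℕ) (hd : 1 ≤ d) (J : Set C(CB d, ℂ)) (hJ : IsClosedIdeal d J)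
    (μ : CMeasure d) (hsing : IsTotallySingularC d μ)
    (hann : ∀ φ ∈ J, cInt d μ φ = 0) :
    μ.var (sphereD d \ ZS d J) = 0 := by
  have hsub : sphereD d \ ZS d J ⊆ ⋃ φ : J, {z | (φ : C(CB d, ℂ)) z ≠ 0} := fun z hz => by
    by_contra h
    refine hz.2 fun φ hφ => ?_
    by_contra hne
    exact h (mem_iUnion.2 ⟨⟨φ, hφ⟩, hne⟩)
  obtain ⟨T, hT, hTU⟩ := TopologicalSpace.isOpen_iUnion_countable
    (fun φ : J => {z | (φ : C(CB d, ℂ)) z ≠ 0})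
    fun φ => isOpen_ne_fun φ.1.continuous continuous_const
  refine measure_mono_null (hsub.trans hTU.ge) ((measure_biUnion_null_iff hT).2 fun φ _ => ?_)
  exact hsing.ae_eq_zero fun f hf => hann _ (hJ.mul_mem f hf φ φ.2)

end
end

section
/- Let E ⊆ 𝕊_d be a Borel set and let φ ∈ A(𝔹_d). Then φ vanishes identically on E if and only if ∫_{𝕊_d} φ dμ = 0 for every A(𝔹_d)-totally singular complex regular Borel measure μ concentrated on E. Equivalently, the pre-annihilator in A(𝔹_d) of the set of A(𝔹_d)-totally singular measures concentrated on E equals the ideal I(E). -/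
open MeasureTheory Metric Set Filter Topology

noncomputable section

/-- The `i`-th coordinate function on the closed ball. -/
def coordFun (d : ℕ) (i : Fin d) : C(CB d, ℂ) :=
  ⟨fun z => (z : EuclideanSpace ℂ (Fin d)) i,
    (EuclideanSpace.proj (𝕜 := ℂ) i).continuous.comp continuous_subtype_val⟩

/-- The function `w ↦ (1 + ⟨w, z⟩) / 2`, which peaks at `z` when `z` is on the sphere. -/
def peakFun (d : ℕ) (z : CB d) : C(CB d, ℂ) :=
  (1 / 2 : ℂ) • (1 + ∑ i, star ((z : EuclideanSpace ℂ (Fin d)) i) • coordFun d i)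

lemma peakFun_mem (d : ℕ) (z : CB d) : peakFun d z ∈ ballAlgSub d := by
  change _ ∈ (polyAlg d).topologicalClosure
  refine Subalgebra.le_topologicalClosure _ ?_
  refine Subalgebra.smul_mem _ (add_mem (one_mem _) (sum_mem fun i _ => ?_)) _
  have hi : coordFun d i ∈ polyAlg d := Algebra.subset_adjoin ⟨i, rfl⟩
  exact Subalgebra.smul_mem _ hi _

lemma peakFun_apply (d : ℕ) (z w : CB d) :
    peakFun d z w = (1 + inner ℂ (z : EuclideanSpace ℂ (Fin d)) w) / 2 := by
  have hi (i : Fin d) : coordFun d i w = (w : EuclideanSpace ℂ (Fin d)) i := rfl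
  simp [peakFun, hi, PiLp.inner_apply, div_eq_inv_mul, mul_add, mul_comm]

lemma peakFun_self (d : ℕ) {z : CB d} (hz : z ∈ sphereD d) : peakFun d z z = 1 := by
  have h : ‖(z : EuclideanSpace ℂ (Fin d))‖ = 1 := hz
  rw [peakFun_apply, inner_self_eq_norm_sq_to_K, h]
  norm_num

lemma norm_peakFun_lt_one (d : ℕ) {z w : CB d} (hz : z ∈ sphereD d) (hw : w ≠ z) :
    ‖peakFun d z w‖ < 1 := by
  have h : ‖(z : EuclideanSpace ℂ (Fin d))‖ = 1 := hz
  have hw1 : ‖(w : EuclideanSpace ℂ (Fin d))‖ ≤ 1 := mem_closedBall_zero_iff.1 w.2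
  rw [peakFun_apply, norm_div, Complex.norm_two, div_lt_one two_pos]
  have hc : ‖inner ℂ (z : EuclideanSpace ℂ (Fin d)) w‖ ≤ 1 := by
    refine (norm_inner_le_norm _ _).trans ?_
    rwa [h, one_mul]
  have hsub : 0 < ‖(z : EuclideanSpace ℂ (Fin d)) - w‖ :=
    norm_pos_iff.2 (sub_ne_zero.2 fun e => hw (Subtype.ext e.symm))
  have hsq := norm_sub_sq (𝕜 := ℂ) (z : EuclideanSpace ℂ (Fin d)) w
  have hadd := norm_add_sq (𝕜 := ℂ) (1 : ℂ) (inner ℂ (z : EuclideanSpace ℂ (Fin d)) w)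
  simp only [RCLike.inner_apply, map_one, mul_one, norm_one, RCLike.re_to_complex] at hadd hsq
  rw [h] at hsq
  have hn := norm_nonneg (w : EuclideanSpace ℂ (Fin d))
  have hn' := norm_nonneg (inner ℂ (z : EuclideanSpace ℂ (Fin d)) w)
  have hpos := pow_pos hsub 2
  refine lt_of_pow_lt_pow_left₀ 2 zero_le_two ?_
  nlinarith

lemma norm_peakFun_le_one (d : ℕ) {z : CB d} (hz : z ∈ sphereD d) (w : CB d) :
    ‖peakFun d z w‖ ≤ 1 := by
  rcases eq_or_ne w z with rfl | hw
  · simp [peakFun_self d hz]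
  · exact (norm_peakFun_lt_one d hz hw).le

/-- Henkin measures have no atoms. -/
lemma IsHenkinC.var_singleton {d : ℕ} {ν : CMeasure d} (hν : IsHenkinC d ν) {z : CB d}
    (hz : z ∈ sphereD d) : ν.var {z} = 0 := by
  have := ν.finite
  have h0 : Tendsto (fun n => cInt d ν (peakFun d z ^ n)) atTop (𝓝 0) := by
    refine hν _ (fun n => pow_mem (peakFun_mem d z) n) ⟨1, fun n => ?_⟩ fun w hw => ?_
    · refine (ContinuousMap.norm_le _ zero_le_one).2 fun w => ?_
      rw [ContinuousMap.pow_apply, norm_pow]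
      exact pow_le_one₀ (norm_nonneg _) (norm_peakFun_le_one d hz w)
    · have hne : w ≠ z := by
        rintro rfl
        have h1 : ‖(w : EuclideanSpace ℂ (Fin d))‖ = 1 := hz
        have h2 : ‖(w : EuclideanSpace ℂ (Fin d))‖ < 1 := hw
        exact h2.ne h1
      simpa using tendsto_pow_atTop_nhds_zero_of_norm_lt_one (norm_peakFun_lt_one d hz hne)
  have h1 : Tendsto (fun n => cInt d ν (peakFun d z ^ n)) atTop
      (𝓝 (∫ w, ({z} : Set (CB d)).indicator (fun _ => ν.density z) w ∂ν.var)) := by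
    refine tendsto_integral_of_dominated_convergence (fun _ => 1) (fun n => ?_)
      (integrable_const _) (fun n => .of_forall fun w => ?_) (.of_forall fun w => ?_)
    · exact ((peakFun d z ^ n).continuous.measurable.mul
        ν.measurable_density).aestronglyMeasurable
    · rw [norm_mul, ν.norm_density, mul_one, ContinuousMap.pow_apply, norm_pow]
      exact pow_le_one₀ (norm_nonneg _) (norm_peakFun_le_one d hz w)
    · rcases eq_or_ne w z with rfl | hw
      · simp [peakFun_self d hz]
      · simpa [hw] using (tendsto_pow_atTop_nhds_zero_of_norm_lt_one
          (norm_peakFun_lt_one d hz hw)).mul_const (ν.density w)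
  have h2 := tendsto_nhds_unique h0 h1
  rw [integral_indicator_const _ (measurableSet_singleton z)] at h2
  have h3 : ν.density z ≠ 0 := norm_ne_zero_iff.1 (by simp [ν.norm_density])
  have h4 := (smul_eq_zero.1 h2.symm).resolve_right h3
  exact (measureReal_eq_zero_iff).1 h4

/-- The point mass at a point of the sphere. -/
def diracC (d : ℕ) (z : CB d) (hz : z ∈ sphereD d) : CMeasure d where
  var := Measure.dirac z
  density := fun _ => 1
  finite := inferInstance
  regular := inferInstance
  measurable_density := measurable_const
  norm_density := by simp
  onSphere := by simp [hz]

lemma isTotallySingularC_diracC (d : ℕ) (z : CB d) (hz : z ∈ sphereD d) :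
    IsTotallySingularC d (diracC d z hz) := fun _ hν =>
  ⟨{z}ᶜ, (measurableSet_singleton z).compl, by simp [diracC],
    by simpa using hν.var_singleton hz⟩

lemma cInt_diracC (d : ℕ) (z : CB d) (hz : z ∈ sphereD d) (φ : C(CB d, ℂ)) :
    cInt d (diracC d z hz) φ = φ z := by
  simp [cInt, diracC]

/-- `φ` vanishes on `E` iff `φ` is annihilated by every totally singular
measure concentrated on `E`. -/
theorem stmt14 (d : ℕ) (hd : 1 ≤ d) (E : Set (CB d)) (hE : E ⊆ sphereD d)
    (hEmeas : MeasurableSet E) (φ : C(CB d, ℂ)) (hφ : φ ∈ ballAlg d) :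
    (∀ z ∈ E, φ z = 0) ↔
      ∀ μ : CMeasure d, IsTotallySingularC d μ → μ.var (sphereD d \ E) = 0 →
        cInt d μ φ = 0 := by
  refine ⟨fun h μ _ hμ => ?_, fun h z hz => ?_⟩
  · refine integral_eq_zero_of_ae ?_
    have hs : ∀ᵐ w ∂μ.var, w ∈ sphereD d := μ.onSphere
    have he : ∀ᵐ w ∂μ.var, w ∉ sphereD d \ E := measure_eq_zero_iff_ae_notMem.1 hμ
    filter_upwards [hs, he] with w hw hw'
    simp [h w (not_not.1 fun hwE => hw' ⟨hw, hwE⟩)]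
  · rw [← cInt_diracC d z (hE hz) φ]
    refine h _ (isTotallySingularC_diracC d z (hE hz)) ?_
    simp [diracC, hz]

end
end
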